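/- arXiv:1705.01360 — 2 statements merged into one kernel-verified Lean document; each statement's English description precedes it below -/
import Mathlib

section
/- Let n ≥ 2, let ∅ ≠ E ⊂ ℝ^n be a closed set, and let 1 < p ≤ q ≤ np/(n−p) < ∞ and β ∈ ℝ be such that dim_A(E) < min{ (q/p)(n−p+β), n − β/(p−1) }. Then there is a constant C > 0 such that the weighted Hardy–Sobolev inequality (∫_{ℝ^n} |f(x)|^q δ_E(x)^{(q/p)(n−p+β)−n} dx)^{1/q} ≤ C (∫_{ℝ^n} |∇f(x)|^p δ_E(x)^β dx)^{1/p} holds for every f ∈ C_0^∞(ℝ^n). -/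
open MeasureTheory Metric Set
open scoped ENNReal NNReal

namespace ApDistance

noncomputable section

variable {X : Type*} [MetricSpace X] [MeasurableSpace X] [BorelSpace X]

/-- All balls of positive radius have positive and finite measure. -/
def BallsPosFinite (μ : Measure X) : Prop :=
  ∀ (x : X) (r : ℝ), 0 < r → 0 < μ (ball x r) ∧ μ (ball x r) < ∞

/-- The measure `μ` is doubling with constant `C`. -/
def DoublingWith (μ : Measure X) (C : ℝ) : Prop :=
  ∀ (x : X) (r : ℝ), 0 < r → μ (ball x (2 * r)) ≤ ENNReal.ofReal C * μ (ball x r)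

/-- The measure `μ` is doubling. -/
def Doubling (μ : Measure X) : Prop :=
  ∃ C : ℝ, 0 < C ∧ DoublingWith μ C

/-- The (quantitative) reverse doubling condition with exponent `η`. -/
def ReverseDoubling (μ : Measure X) (η : ℝ) : Prop :=
  ∃ C : ℝ, 0 < C ∧ ∀ (x y : X) (r R : ℝ), 0 < r → 0 < R → ball y r ⊆ ball x R →
    μ (ball y r) ≤ ENNReal.ofReal (C * (r / R) ^ η) * μ (ball x R)

/-- Standing assumptions (S1)-(S2): `X` is unbounded, points have measure zero,
and all annuli are nonempty. -/
def StandingAssumptions (μ : Measure X) : Prop :=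
  ¬ Bornology.IsBounded (univ : Set X) ∧ (∀ x : X, μ {x} = 0) ∧
    ∀ (x : X) (r R : ℝ), 0 < r → r < R → (ball x R \ ball x r).Nonempty

/-- Ahlfors `Q`-regularity of the metric measure space. -/
def AhlforsRegular (μ : Measure X) (Q : ℝ) : Prop :=
  ∃ C : ℝ, 1 ≤ C ∧ ∀ (x : X) (r : ℝ), 0 < r → ENNReal.ofReal r < EMetric.diam (univ : Set X) →
    ENNReal.ofReal (C⁻¹ * r ^ Q) ≤ μ (ball x r) ∧ μ (ball x r) ≤ ENNReal.ofReal (C * r ^ Q)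

/-- The set of admissible exponents in the definition of the (upper) Assouad dimension:
`E ∩ B(x,R)` can be covered by at most `C (R/r)^s` balls of radius `r`. -/
def assouadDimBddSet (E : Set X) : Set ℝ :=
  {s : ℝ | 0 ≤ s ∧ ∃ C : ℝ, 1 ≤ C ∧ ∀ x ∈ E, ∀ r R : ℝ, 0 < r → r < R →
    ENNReal.ofReal R < 2 * EMetric.diam (univ : Set X) →
    ∃ F : Finset X, (F.card : ℝ) ≤ C * (R / r) ^ s ∧ E ∩ ball x R ⊆ ⋃ y ∈ F, ball y r}

/-- The (upper) Assouad dimension of a set `E`. -/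
def assouadDim (E : Set X) : ℝ := sInf (assouadDimBddSet E)

/-- The set of admissible exponents in the definition of the lower Assouad codimension. -/
def assouadCodimBddSet (μ : Measure X) (E : Set X) : Set ℝ :=
  {ρ : ℝ | 0 ≤ ρ ∧ ∃ C : ℝ, 1 ≤ C ∧ ∀ x ∈ E, ∀ r R : ℝ, 0 < r → r < R →
    ENNReal.ofReal R < 2 * EMetric.diam (univ : Set X) →
    μ ({y : X | infDist y E < r} ∩ ball x R) ≤
      ENNReal.ofReal (C * (r / R) ^ ρ) * μ (ball x R)}

/-- The lower Assouad codimension of a set `E` with respect to `μ`. -/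
def assouadCodim (μ : Measure X) (E : Set X) : ℝ := sSup (assouadCodimBddSet μ E)

/-- Porosity of a set `E ⊆ X`. -/
def IsPorous (E : Set X) : Prop :=
  ∃ c : ℝ, 0 < c ∧ c < 1 ∧ ∀ x ∈ E, ∀ r : ℝ, 0 < r →
    ENNReal.ofReal r < 2 * EMetric.diam (univ : Set X) →
    ∃ y : X, ball y (c * r) ⊆ ball x r \ E

/-- A weight: measurable, a.e. positive and finite, locally integrable on balls. -/
def IsWeight (μ : Measure X) (w : X → ℝ≥0∞) : Prop :=
  Measurable w ∧ (∀ᵐ x ∂μ, 0 < w x ∧ w x ≠ ∞) ∧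
    ∀ (x : X) (r : ℝ), 0 < r → ∫⁻ y in ball x r, w y ∂μ ≠ ∞

/-- Membership in the Muckenhoupt class `A_p`, `1 < p < ∞`. -/
def MemAp (μ : Measure X) (w : X → ℝ≥0∞) (p : ℝ) : Prop :=
  IsWeight μ w ∧ ∃ A : ℝ, 0 < A ∧ ∀ (x : X) (r : ℝ), 0 < r →
    ((∫⁻ y in ball x r, w y ∂μ) / μ (ball x r)) *
      ((∫⁻ y in ball x r, w y ^ (-(1 / (p - 1))) ∂μ) / μ (ball x r)) ^ (p - 1) ≤
      ENNReal.ofReal A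

/-- Membership in the Muckenhoupt class `A_1`. -/
def MemA1 (μ : Measure X) (w : X → ℝ≥0∞) : Prop :=
  IsWeight μ w ∧ ∃ A : ℝ, 0 < A ∧ ∀ (x : X) (r : ℝ), 0 < r →
    ((∫⁻ y in ball x r, w y ∂μ) / μ (ball x r)) *
      essSup (fun y => (w y)⁻¹) (μ.restrict (ball x r)) ≤ ENNReal.ofReal A

/-- Membership in the Muckenhoupt class `A_∞`. -/
def MemAinfty (μ : Measure X) (w : X → ℝ≥0∞) : Prop :=
  IsWeight μ w ∧ ∃ C d : ℝ, 0 < C ∧ 0 < d ∧ ∀ (x : X) (r : ℝ), 0 < r →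
    ∀ F : Set X, MeasurableSet F → F ⊆ ball x r →
      ∫⁻ y in F, w y ∂μ ≤
        ENNReal.ofReal C * (μ F / μ (ball x r)) ^ d * ∫⁻ y in ball x r, w y ∂μ

/-- The weight `w = δ_E^{-α} = dist(·,E)^{-α}` (with values in `ℝ≥0∞`). -/
def distWeight (E : Set X) (α : ℝ) : X → ℝ≥0∞ :=
  fun x => ENNReal.ofReal (infDist x E) ^ (-α)

/-- The Aikawa condition with exponent `α` and constant `C`. -/
def AikawaCondition (μ : Measure X) (E : Set X) (α C : ℝ) : Prop :=
  ∀ x ∈ E, ∀ r : ℝ, 0 < r → ENNReal.ofReal r < 2 * EMetric.diam (univ : Set X) →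
    ∫⁻ y in ball x r, ENNReal.ofReal (infDist y E) ^ (-α) ∂μ ≤
      ENNReal.ofReal (C * r ^ (-α)) * μ (ball x r)

/-- The Riesz potential `I_s f`. -/
def rieszPotential (μ : Measure X) (s : ℝ) (f : X → ℝ≥0∞) (x : X) : ℝ≥0∞ :=
  ∫⁻ y, f y * ENNReal.ofReal (dist x y ^ s) / μ (ball x (dist x y)) ∂μ

/-- `Lip_0(X)`: Lipschitz functions vanishing outside some ball. -/
def MemLip0 (f : X → ℝ) : Prop :=
  (∃ K : ℝ≥0, LipschitzWith K f) ∧ ∃ (x : X) (r : ℝ), ∀ y : X, y ∉ ball x r → f y = 0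

/-- The `λ`-chain condition. -/
def ChainCondition (X : Type*) [MetricSpace X] (lam : ℝ) : Prop :=
  ∃ M : ℝ, 1 ≤ M ∧ ∀ (x : X) (r R : ℝ), 0 < r → r < R →
    ∃ (k : ℕ) (c : ℕ → X) (ρ : ℕ → ℝ),
      (∀ i ≤ k, 0 < ρ i) ∧
      ball (c 0) (lam * ρ 0) ⊆ (ball x R)ᶜ ∧
      ball (c k) (lam * ρ k) ⊆ ball x r ∧
      (∀ i ≤ k,
        M⁻¹ * Metric.diam (ball (c i) (lam * ρ i)) ≤ infDist x (ball (c i) (lam * ρ i)) ∧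
        infDist x (ball (c i) (lam * ρ i)) ≤ M * Metric.diam (ball (c i) (lam * ρ i))) ∧
      (∀ i < k, ∃ (z : X) (t : ℝ), 0 < t ∧
        ball z t ⊆ ball (c i) (ρ i) ∩ ball (c (i + 1)) (ρ (i + 1)) ∧
        ball (c i) (ρ i) ∪ ball (c (i + 1)) (ρ (i + 1)) ⊆ ball z (M * t)) ∧
      (∀ y : X, (({i : ℕ | i ≤ k ∧ y ∈ ball (c i) (lam * ρ i)}).ncard : ℝ) ≤ M)

/-- The inner integral appearing in fractional Hardy–Sobolev inequalities:
`y ↦ ∫_X |f(y)-f(z)|^t / (d(y,z)^{st} μ(B(y,d(y,z)))) dμ(z)`. -/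
def fracEnergyKernel (μ : Measure X) (s t : ℝ) (f : X → ℝ) (y : X) : ℝ≥0∞ :=
  ∫⁻ z, ENNReal.ofReal (|f y - f z| ^ t) /
    (ENNReal.ofReal (dist y z ^ (s * t)) * μ (ball y (dist y z))) ∂μ


/-- Euclidean space. -/
abbrev EV (n : ℕ) := EuclideanSpace ℝ (Fin n)

lemma scale_lintegral {n : ℕ} (F : EV n → ℝ≥0∞) (z : EV n) {r : ℝ} (hr : 0 < r) :
    ∫⁻ w, F (z + r • w) = ENNReal.ofReal ((r ^ n)⁻¹) * ∫⁻ x, F x := by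
  have h1 : ∫⁻ w, F (z + r • w) = ∫⁻ x, F (z + x) ∂(Measure.map (r • ·) (volume : Measure (EV n))) := by
    have := (Homeomorph.smul (isUnit_iff_ne_zero.2 hr.ne').unit :
      EV n ≃ₜ EV n).toMeasurableEquiv.measurableEmbedding.lintegral_map
        (μ := (volume : Measure (EV n))) (fun x => F (z + x))
    exact this.symm
  rw [h1, Measure.map_addHaar_smul _ hr.ne', lintegral_smul_measure, lintegral_add_left_eq_self]
  simp [abs_of_pos hr]

lemma scale_setLIntegral {n : ℕ} (F : EV n → ℝ≥0∞) (z : EV n) {r : ℝ} (hr : 0 < r) (a : ℝ) :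
    ∫⁻ w in ball 0 a, F (z + r • w) = ENNReal.ofReal ((r ^ n)⁻¹) * ∫⁻ x in ball z (r * a), F x := by
  rw [← lintegral_indicator measurableSet_ball, ← lintegral_indicator measurableSet_ball,
    ← scale_lintegral _ z hr]
  congr 1
  ext w
  simp only [indicator, mem_ball, dist_self_add_left, dist_zero_right, norm_smul, Real.norm_eq_abs,
    abs_of_pos hr]
  simp [mul_lt_mul_iff_right₀ hr]

lemma tail_integral {a r : ℝ} (ha : 0 < a) (hr : 0 < r) :
    ∫⁻ t in Ioi r, ENNReal.ofReal (t ^ (-a - 1)) = ENNReal.ofReal (r ^ (-a) / a) := by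
  rw [← ofReal_integral_eq_lintegral_ofReal (integrableOn_Ioi_rpow_of_lt (by linarith) hr),
    integral_Ioi_rpow_of_lt (by linarith) hr]
  · congr 1
    rw [show -a - 1 + 1 = -a by ring, neg_div_neg_eq]
  · filter_upwards [ae_restrict_mem measurableSet_Ioi] with t ht
    exact Real.rpow_nonneg (hr.le.trans (le_of_lt ht)) _

lemma head_integral {e R : ℝ} (he : 0 < e) (hR : 0 < R) :
    ∫⁻ t in Ioc 0 R, ENNReal.ofReal (t ^ (e - 1)) = ENNReal.ofReal (R ^ e / e) := by
  have hi : IntervalIntegrable (fun t : ℝ => t ^ (e - 1)) volume 0 R :=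
    intervalIntegral.intervalIntegrable_rpow' (by linarith)
  rw [intervalIntegrable_iff_integrableOn_Ioc_of_le hR.le] at hi
  rw [← ofReal_integral_eq_lintegral_ofReal hi,
    ← intervalIntegral.integral_of_le hR.le, integral_rpow (Or.inl (by linarith))]
  · congr 1
    rw [show e - 1 + 1 = e by ring, Real.zero_rpow he.ne', sub_zero]
  · filter_upwards [ae_restrict_mem measurableSet_Ioc] with t ht
    exact Real.rpow_nonneg (le_of_lt ht.1) _

lemma vol_ball {n : ℕ} (x : EV n) {r : ℝ} (hr : 0 < r) :
    volume (ball x r) = ENNReal.ofReal (r ^ n) * volume (ball (0 : EV n) 1) := by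
  rw [Measure.addHaar_ball_of_pos _ _ hr]; simp

/-- Finite doubling cover. -/
lemma exists_cover_dyadic (n : ℕ) : ∃ N : ℕ, 2 ≤ N ∧ ∀ k : ℕ, ∃ F : Finset (EV n),
    F.card ≤ N ^ k ∧ ball (0 : EV n) 1 ⊆ ⋃ y ∈ F, ball y ((2 : ℝ)⁻¹ ^ k) := by
  classical
  obtain ⟨F1, hF1⟩ : ∃ F1 : Finset (EV n), ball (0 : EV n) 1 ⊆ ⋃ y ∈ F1, ball y 2⁻¹ := by
    have hc : IsCompact (closedBall (0 : EV n) 1) := isCompact_closedBall _ _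
    obtain ⟨t, -, ht⟩ := hc.elim_nhds_subcover (fun x => ball x 2⁻¹)
      (fun x _ => ball_mem_nhds x (by norm_num))
    exact ⟨t, ball_subset_closedBall.trans ht⟩
  refine ⟨F1.card + 2, by omega, fun k => ?_⟩
  induction k with
  | zero => exact ⟨{0}, by simp, by simp⟩
  | succ k ih =>
    obtain ⟨F, hc, hF⟩ := ih
    refine ⟨(F ×ˢ F1).image (fun q => q.1 + (2 : ℝ)⁻¹ ^ k • q.2), ?_, ?_⟩
    · refine Finset.card_image_le.trans ?_
      rw [Finset.card_product, pow_succ]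
      exact Nat.mul_le_mul hc (by omega)
    · intro x hx
      have := hF hx
      simp only [mem_iUnion, exists_prop] at this
      obtain ⟨y, hy, hxy⟩ := this
      have h2 : (0 : ℝ) < 2⁻¹ ^ k := by positivity
      have hw : ((2 : ℝ)⁻¹ ^ k)⁻¹ • (x - y) ∈ ball (0 : EV n) 1 := by
        rw [mem_ball, dist_eq_norm] at hxy
        rw [mem_ball_zero_iff, norm_smul, norm_inv, Real.norm_of_nonneg h2.le]
        rw [inv_mul_lt_iff₀ h2]; simpa using hxy
      have := hF1 hw
      simp only [mem_iUnion, exists_prop] at this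
      obtain ⟨v, hv, hvw⟩ := this
      simp only [mem_iUnion, exists_prop]
      refine ⟨y + (2 : ℝ)⁻¹ ^ k • v, Finset.mem_image.2 ⟨(y, v), by simp [hy, hv], rfl⟩, ?_⟩
      rw [mem_ball, dist_eq_norm] at hvw ⊢
      have : x - (y + (2 : ℝ)⁻¹ ^ k • v) =
          (2 : ℝ)⁻¹ ^ k • (((2 : ℝ)⁻¹ ^ k)⁻¹ • (x - y) - v) := by
        rw [smul_sub, smul_smul, mul_inv_cancel₀ h2.ne', one_smul]; abel
      rw [this, norm_smul, Real.norm_of_nonneg h2.le, pow_succ]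
      exact mul_lt_mul_of_pos_left hvw h2

lemma assouadDimBddSet_nonempty {n : ℕ} (E : Set (EV n)) : (assouadDimBddSet E).Nonempty := by
  classical
  obtain ⟨N, hN2, hN⟩ := exists_cover_dyadic n
  have hN1 : (1 : ℝ) < N := by exact_mod_cast (by omega : 1 < N)
  have hl : 0 ≤ Real.logb 2 N := Real.logb_nonneg (by norm_num) hN1.le
  refine ⟨Real.logb 2 N, hl, N, hN1.le, ?_⟩
  intro x _ r R hr hrR _
  have hR : 0 < R := hr.trans hrR
  set k := ⌈Real.logb 2 (R / r)⌉₊ with hk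
  obtain ⟨F, hFc, hF⟩ := hN k
  have hRr : 1 ≤ R / r := by rw [le_div_iff₀ hr]; linarith
  have hL0 : 0 ≤ Real.logb 2 (R / r) := Real.logb_nonneg (by norm_num) hRr
  have hk1 : Real.logb 2 (R / r) ≤ k := Nat.le_ceil _
  have hk2 : (k : ℝ) < Real.logb 2 (R / r) + 1 := Nat.ceil_lt_add_one hL0
  refine ⟨F.image (fun y => x + R • y), ?_, ?_⟩
  · calc (((F.image (fun y => x + R • y)).card : ℕ) : ℝ) ≤ ((N ^ k : ℕ) : ℝ) := by
          exact_mod_cast Finset.card_image_le.trans hFc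
      _ = (N : ℝ) ^ (k : ℝ) := by push_cast; rw [Real.rpow_natCast]
      _ ≤ (N : ℝ) ^ (Real.logb 2 (R / r) + 1) :=
          Real.rpow_le_rpow_of_exponent_le hN1.le hk2.le
      _ = N * (R / r) ^ Real.logb 2 N := by
          rw [Real.rpow_add (by linarith), Real.rpow_one, mul_comm]
          congr 1
          rw [Real.rpow_def_of_pos (by linarith), Real.rpow_def_of_pos (by linarith)]
          simp only [Real.logb]
          congr 1; ring
  · rintro y ⟨-, hy⟩
    have hw : R⁻¹ • (y - x) ∈ ball (0 : EV n) 1 := by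
      rw [mem_ball, dist_eq_norm] at hy
      rw [mem_ball_zero_iff, norm_smul, norm_inv, Real.norm_of_nonneg hR.le,
        inv_mul_lt_iff₀ hR]; simpa using hy
    have := hF hw
    simp only [mem_iUnion, exists_prop] at this
    obtain ⟨v, hv, hvw⟩ := this
    simp only [mem_iUnion, exists_prop]
    refine ⟨x + R • v, Finset.mem_image.2 ⟨v, hv, rfl⟩, ?_⟩
    rw [mem_ball, dist_eq_norm] at hvw ⊢
    have e : y - (x + R • v) = R • (R⁻¹ • (y - x) - v) := by
      rw [smul_sub, smul_smul, mul_inv_cancel₀ hR.ne', one_smul]; abel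
    rw [e, norm_smul, Real.norm_of_nonneg hR.le]
    have h3 : R * (2 : ℝ)⁻¹ ^ k ≤ r := by
      have : R / r ≤ 2 ^ k := by
        rw [← Real.rpow_natCast]
        calc R / r = 2 ^ (Real.logb 2 (R / r)) := by
              rw [Real.rpow_logb (by norm_num) (by norm_num) (by linarith)]
          _ ≤ _ := Real.rpow_le_rpow_of_exponent_le (by norm_num) hk1
      rw [div_le_iff₀ hr] at this
      rw [inv_pow, ← div_eq_mul_inv, div_le_iff₀ (by positivity)]; linarith
    exact (mul_lt_mul_of_pos_left hvw hR).trans_le h3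

lemma layer {α : Type*} [MeasurableSpace α] (μ : Measure α) [SFinite μ] {h : α → ℝ}
    (hm : Measurable h) (hpos : ∀ᵐ y ∂μ, 0 < h y) {a : ℝ} (ha : 0 < a) :
    ∫⁻ y, ENNReal.ofReal (h y) ^ (-a) ∂μ =
      ENNReal.ofReal a * ∫⁻ t in Ioi (0 : ℝ), ENNReal.ofReal (t ^ (-a - 1)) * μ {y | h y < t} := by
  have h1 : ∀ᵐ y ∂μ, ENNReal.ofReal (h y) ^ (-a) = ENNReal.ofReal a *
      ∫⁻ t in Ioi (0 : ℝ), ENNReal.ofReal (t ^ (-a - 1)) * {q : α × ℝ | h q.1 < q.2}.indicator 1 (y, t) := by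
    filter_upwards [hpos] with y hy
    have : ∫⁻ t in Ioi (0 : ℝ), ENNReal.ofReal (t ^ (-a - 1)) *
        {q : α × ℝ | h q.1 < q.2}.indicator 1 (y, t) =
        ∫⁻ t in Ioi (h y), ENNReal.ofReal (t ^ (-a - 1)) := by
      rw [← lintegral_indicator measurableSet_Ioi, ← lintegral_indicator measurableSet_Ioi]
      congr 1; ext t
      by_cases ht : h y < t
      · simp [indicator, ht, hy.trans ht]
      · simp [indicator, ht]
    rw [this, tail_integral ha hy, ← ENNReal.ofReal_mul ha.le, ENNReal.ofReal_rpow_of_pos hy]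
    congr 1; field_simp
  have hms : MeasurableSet {q : α × ℝ | h q.1 < q.2} :=
    measurableSet_lt (hm.comp measurable_fst) measurable_snd
  have hmi : Measurable (fun q : α × ℝ => ENNReal.ofReal (q.2 ^ (-a - 1)) *
      {q : α × ℝ | h q.1 < q.2}.indicator (1 : α × ℝ → ℝ≥0∞) q) := by
    refine Measurable.mul (by fun_prop) (measurable_one.indicator hms)
  rw [lintegral_congr_ae h1, lintegral_const_mul' _ _ ENNReal.ofReal_ne_top,
    lintegral_lintegral_swap hmi.aemeasurable]
  congr 1
  apply lintegral_congr
  intro t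
  rw [lintegral_const_mul' _ _ ENNReal.ofReal_ne_top]
  congr 1
  rw [← lintegral_indicator_one (measurableSet_lt hm measurable_const)]
  rfl

/-- Covering data extracted from the Assouad dimension. -/
def CovData {n : ℕ} (E : Set (EV n)) (s C : ℝ) : Prop :=
  ∀ x ∈ E, ∀ r R : ℝ, 0 < r → r < R →
    ∃ F : Finset (EV n), (F.card : ℝ) ≤ C * (R / r) ^ s ∧ E ∩ ball x R ⊆ ⋃ y ∈ F, ball y r

lemma exists_covData {n : ℕ} (hn : 2 ≤ n) (E : Set (EV n)) {m : ℝ} (h : assouadDim E < m) :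
    ∃ s C : ℝ, 0 ≤ s ∧ s < m ∧ 1 ≤ C ∧ CovData E s C := by
  obtain ⟨s, ⟨hs0, C, hC, hcov⟩, hsm⟩ := exists_lt_of_csInf_lt (assouadDimBddSet_nonempty E) h
  refine ⟨s, C, hs0, hsm, hC, fun x hx r R hr hrR => hcov x hx r R hr hrR ?_⟩
  have : Nonempty (Fin n) := ⟨⟨0, by omega⟩⟩
  have : Nontrivial (EV n) := inferInstance
  have : ediam (univ : Set (EV n)) = ∞ := by
    by_contra hh
    have hb : Bornology.IsBounded (univ : Set (EV n)) := isBounded_iff_ediam_ne_top.2 hh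
    exact NormedSpace.unbounded_univ ℝ (EV n) hb
  have h2 : EMetric.diam (univ : Set (EV n)) = ∞ := this
  rw [h2]
  simp [ENNReal.mul_top]

lemma meas_nbhd {n : ℕ} {E : Set (EV n)} {s C : ℝ} (hC : 1 ≤ C) (hcov : CovData E s C) :
    ∃ K : ℝ, 0 < K ∧ ∀ x ∈ E, ∀ t R : ℝ, 0 < t → t ≤ R →
      volume ({y | infDist y E < t} ∩ ball x R) ≤ ENNReal.ofReal (K * R ^ s * t ^ (n - s)) := by
  have hB : volume (ball (0 : EV n) 1) ≠ ∞ := measure_ball_lt_top.ne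
  have hB0 : 0 < volume (ball (0 : EV n) 1) := measure_ball_pos _ _ one_pos
  set v := (volume (ball (0 : EV n) 1)).toReal with hv
  have hvpos : 0 < v := ENNReal.toReal_pos hB0.ne' hB
  refine ⟨C * 2 ^ s * 2 ^ n * v, by positivity, ?_⟩
  intro x hx t R ht htR
  have hR : 0 < R := ht.trans_le htR
  obtain ⟨F, hFc, hF⟩ := hcov x hx t (2 * R) ht (by linarith)
  have hsub : {y | infDist y E < t} ∩ ball x R ⊆ ⋃ y ∈ F, ball y (2 * t) := by
    rintro y ⟨hy, hyx⟩
    obtain ⟨e, he, hye⟩ := (infDist_lt_iff ⟨x, hx⟩).1 hy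
    have hyx' : dist y x < R := hyx
    have hex : e ∈ ball x (2 * R) := by
      have := dist_triangle e y x
      rw [dist_comm e y] at this
      rw [mem_ball]; linarith
    have := hF ⟨he, hex⟩
    simp only [mem_iUnion, exists_prop] at this ⊢
    obtain ⟨c, hc, hec⟩ := this
    refine ⟨c, hc, ?_⟩
    rw [mem_ball] at hec ⊢
    have := dist_triangle y e c
    linarith
  calc volume ({y | infDist y E < t} ∩ ball x R) ≤ volume (⋃ y ∈ F, ball y (2 * t)) :=
        measure_mono hsub
    _ ≤ ∑ y ∈ F, volume (ball y (2 * t)) := measure_biUnion_finset_le _ _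
    _ = ∑ y ∈ F, ENNReal.ofReal ((2 * t) ^ n * v) := by
        refine Finset.sum_congr rfl fun y _ => ?_
        rw [vol_ball y (by linarith), ENNReal.ofReal_mul (by positivity), hv, ENNReal.ofReal_toReal hB]
    _ = ENNReal.ofReal (F.card * ((2 * t) ^ n * v)) := by
        rw [Finset.sum_const, nsmul_eq_mul, ENNReal.ofReal_mul (Nat.cast_nonneg F.card), ENNReal.ofReal_natCast]
    _ ≤ _ := by
        apply ENNReal.ofReal_le_ofReal
        calc (F.card : ℝ) * ((2 * t) ^ n * v) ≤ C * (2 * R / t) ^ s * ((2 * t) ^ n * v) := by gcongr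
          _ = _ := by
            rw [Real.rpow_sub ht, Real.rpow_natCast, Real.div_rpow (by positivity) ht.le,
              Real.mul_rpow (by norm_num) hR.le, mul_pow]
            field_simp

lemma vol_E {n : ℕ} {E : Set (EV n)} {s C : ℝ} (hC : 1 ≤ C) (hcov : CovData E s C)
    (hsn : s < n) : volume E = 0 := by
  obtain ⟨K, hK, h⟩ := meas_nbhd hC hcov
  rcases E.eq_empty_or_nonempty with rfl | ⟨x, hx⟩
  · simp
  have hball : ∀ R : ℕ, volume (E ∩ ball x (R + 1)) = 0 := by
    intro R
    have hlim : Filter.Tendsto (fun t : ℝ => ENNReal.ofReal (K * (R + 1 : ℝ) ^ s * t ^ (n - s)))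
        (nhdsWithin 0 (Ioi 0)) (nhds 0) := by
      have h1 : Filter.Tendsto (fun t : ℝ => K * (R + 1 : ℝ) ^ s * t ^ (n - s)) (nhds 0) (nhds 0) := by
        have := (Real.continuousAt_rpow_const 0 (n - s) (Or.inr (by linarith))).tendsto.const_mul
          (K * (R + 1 : ℝ) ^ s)
        rwa [Real.zero_rpow (by linarith), mul_zero] at this
      have := (ENNReal.continuous_ofReal.tendsto 0).comp h1
      rw [ENNReal.ofReal_zero] at this
      exact this.mono_left nhdsWithin_le_nhds
    refine le_antisymm (ge_of_tendsto hlim ?_) (zero_le)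
    have : Ioo (0 : ℝ) (R + 1) ∈ nhdsWithin (0 : ℝ) (Ioi 0) := Ioo_mem_nhdsGT (by positivity)
    filter_upwards [this] with t ht
    refine (measure_mono ?_).trans (h x hx t (R + 1) ht.1 ht.2.le)
    rintro y ⟨hy, hyb⟩
    exact ⟨by simpa [infDist_zero_of_mem hy] using ht.1, hyb⟩
  have : E ⊆ ⋃ R : ℕ, E ∩ ball x (R + 1) := by
    intro y hy
    obtain ⟨R, hR⟩ := exists_nat_gt (dist y x)
    exact mem_iUnion.2 ⟨R, hy, by rw [mem_ball]; linarith⟩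
  exact measure_mono_null this (measure_iUnion_null hball)

lemma ae_pos {n : ℕ} {E : Set (EV n)} (hE : E.Nonempty) (hEc : IsClosed E) (h0 : volume E = 0) :
    ∀ᵐ y : EV n, 0 < infDist y E := by
  have : ∀ᵐ y : EV n, y ∉ E := measure_eq_zero_iff_ae_notMem.1 h0
  filter_upwards [this] with y hy
  exact (hEc.notMem_iff_infDist_pos hE).1 hy

lemma aikawa {n : ℕ} {E : Set (EV n)} (hE : E.Nonempty) (hEc : IsClosed E) {s C b : ℝ}
    (hs : 0 ≤ s) (hC : 1 ≤ C) (hcov : CovData E s C) (hsn : s < n) (hb : b < n - s) :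
    ∃ K : ℝ, 0 < K ∧ ∀ x ∈ E, ∀ R : ℝ, 0 < R →
      ∫⁻ y in ball x R, ENNReal.ofReal (infDist y E) ^ (-b) ≤ ENNReal.ofReal (K * R ^ (n - b)) := by
  have hB : volume (ball (0 : EV n) 1) ≠ ∞ := measure_ball_lt_top.ne
  have hB0 : 0 < volume (ball (0 : EV n) 1) := measure_ball_pos _ _ one_pos
  set v := (volume (ball (0 : EV n) 1)).toReal with hv
  have hvpos : 0 < v := ENNReal.toReal_pos hB0.ne' hB
  have hvb : ∀ (x : EV n) (R : ℝ), 0 < R → volume (ball x R) = ENNReal.ofReal (R ^ (n : ℝ) * v) := by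
    intro x R hR
    rw [vol_ball x hR, ENNReal.ofReal_mul (by positivity), hv, ENNReal.ofReal_toReal hB,
      Real.rpow_natCast]
  rcases le_or_gt b 0 with hb0 | hb0
  · refine ⟨v, hvpos, fun x hx R hR => ?_⟩
    calc ∫⁻ y in ball x R, ENNReal.ofReal (infDist y E) ^ (-b)
        ≤ ∫⁻ y in ball x R, ENNReal.ofReal R ^ (-b) := by
          refine setLIntegral_mono measurable_const fun y hy => ?_
          refine ENNReal.rpow_le_rpow (ENNReal.ofReal_le_ofReal ?_) (by linarith)
          exact (infDist_le_dist_of_mem hx).trans (le_of_lt hy)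
      _ = ENNReal.ofReal (v * R ^ (n - b)) := by
          rw [setLIntegral_const, hvb x R hR, ENNReal.ofReal_rpow_of_pos hR,
            ← ENNReal.ofReal_mul (by positivity)]
          congr 1
          rw [sub_eq_add_neg, Real.rpow_add hR]; ring
      _ ≤ _ := le_rfl
  · obtain ⟨K, hK, hnb⟩ := meas_nbhd hC hcov
    have he : 0 < n - s - b := by linarith
    refine ⟨b * (K / (n - s - b) + v / b), by positivity, fun x hx R hR => ?_⟩
    rw [layer (volume.restrict (ball x R)) (continuous_infDist_pt E).measurable
      (ae_restrict_of_ae (ae_pos hE hEc (vol_E hC hcov hsn))) hb0]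
    have hms : ∀ t : ℝ, MeasurableSet {y : EV n | infDist y E < t} := fun t =>
      measurableSet_lt (continuous_infDist_pt E).measurable measurable_const
    have hun : Ioi (0 : ℝ) = Ioc 0 R ∪ Ioi R := (Ioc_union_Ioi_eq_Ioi hR.le).symm
    have h1 : ∫⁻ t in Ioc 0 R, ENNReal.ofReal (t ^ (-b - 1)) *
        (volume.restrict (ball x R)) {y | infDist y E < t} ≤
        ENNReal.ofReal (K * R ^ s * (R ^ (n - s - b) / (n - s - b))) := by
      rw [ENNReal.ofReal_mul (by positivity), ← head_integral he hR,
        ← lintegral_const_mul' _ _ ENNReal.ofReal_ne_top]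
      refine setLIntegral_mono' measurableSet_Ioc fun t ht => ?_
      rw [Measure.restrict_apply (hms t)]
      refine (mul_le_mul_right (hnb x hx t R ht.1 ht.2) _).trans (le_of_eq ?_)
      have ht0 := ht.1
      rw [← ENNReal.ofReal_mul (by positivity), ← ENNReal.ofReal_mul (by positivity)]
      congr 1
      rw [show (n : ℝ) - s - b - 1 = (-b - 1) + (n - s) by ring, Real.rpow_add ht.1 (-b - 1)]
      ring
    have h2 : ∫⁻ t in Ioi R, ENNReal.ofReal (t ^ (-b - 1)) *
        (volume.restrict (ball x R)) {y | infDist y E < t} ≤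
        ENNReal.ofReal (R ^ (n : ℝ) * v * (R ^ (-b) / b)) := by
      rw [ENNReal.ofReal_mul (by positivity), ← tail_integral hb0 hR,
        ← lintegral_const_mul' _ _ ENNReal.ofReal_ne_top]
      refine setLIntegral_mono' measurableSet_Ioi fun t ht => ?_
      rw [mul_comm, ← hvb x R hR, Measure.restrict_apply (hms t)]
      exact mul_le_mul_left (measure_mono inter_subset_right) _
    calc _ ≤ ENNReal.ofReal b * (ENNReal.ofReal (K * R ^ s * (R ^ (n - s - b) / (n - s - b))) +
            ENNReal.ofReal (R ^ (n : ℝ) * v * (R ^ (-b) / b))) := by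
          gcongr
          rw [hun]
          exact (lintegral_union_le _ _ _).trans (add_le_add h1 h2)
      _ = _ := by
          rw [← ENNReal.ofReal_add (by positivity) (by positivity), ← ENNReal.ofReal_mul hb0.le]
          congr 1
          have e1 : R ^ (n - b) = R ^ s * R ^ (n - s - b) := by
            rw [← Real.rpow_add hR]; congr 1; ring
          have e2 : R ^ (n - b) = R ^ (n : ℝ) * R ^ (-b) := by
            rw [← Real.rpow_add hR]; congr 1
          have : b * (K / (n - s - b) + v / b) * R ^ (n - b) =
            b * (K / (n - s - b)) * R ^ (n - b) + b * (v / b) * R ^ (n - b) := by ring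
          rw [this]
          nth_rw 1 [e1]
          rw [e2]; ring

/-- Key kernel estimate. -/
lemma kernel_est {n : ℕ} {E : Set (EV n)} (hE : E.Nonempty) (hEc : IsClosed E) {s C a b : ℝ}
    (hs : 0 ≤ s) (hC : 1 ≤ C) (hcov : CovData E s C) (hsn : s < n) (hb : b < n - s) (ha : 0 < a)
    (hab : n < a + b) :
    ∃ K : ℝ, 0 < K ∧ ∀ x : EV n, 0 < infDist x E →
      ∫⁻ y, ENNReal.ofReal (infDist x E + dist x y) ^ (-a) * ENNReal.ofReal (infDist y E) ^ (-b) ≤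
        ENNReal.ofReal K * ENNReal.ofReal (infDist x E) ^ (n - a - b) := by
  obtain ⟨K, hK, hA⟩ := aikawa hE hEc hs hC hcov hsn hb
  have hc : 0 < a + b - n := by linarith
  refine ⟨a * (K * 2 ^ (n - b) * (1 / (a + b - n))), by positivity, fun x hx => ?_⟩
  have hmd : Measurable fun y : EV n => infDist y E := (continuous_infDist_pt E).measurable
  have hmw : Measurable fun y : EV n => ENNReal.ofReal (infDist y E) ^ (-b) := by fun_prop
  have hmh : Measurable fun y : EV n => infDist x E + dist x y := by fun_prop
  set μ := (volume : Measure (EV n)).withDensity (fun y => ENNReal.ofReal (infDist y E) ^ (-b)) with hμ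
  have e1 : ∫⁻ y, ENNReal.ofReal (infDist x E + dist x y) ^ (-a) * ENNReal.ofReal (infDist y E) ^ (-b)
      = ∫⁻ y, ENNReal.ofReal (infDist x E + dist x y) ^ (-a) ∂μ := by
    rw [hμ, lintegral_withDensity_eq_lintegral_mul _ hmw (by fun_prop)]
    simp only [Pi.mul_apply, mul_comm]
  rw [e1, layer μ hmh (Filter.Eventually.of_forall fun y => by positivity) ha]
  have h1 : ∀ t : ℝ, 0 < t → ENNReal.ofReal (t ^ (-a - 1)) * μ {y | infDist x E + dist x y < t} ≤
      (Ioi (infDist x E)).indicator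
        (fun t => ENNReal.ofReal (K * 2 ^ (n - b)) * ENNReal.ofReal (t ^ (-(a + b - n) - 1))) t := by
    intro t ht
    by_cases htx : infDist x E < t
    · rw [indicator_of_mem (show t ∈ Ioi (infDist x E) from htx)]
      obtain ⟨e, he, hxe⟩ := (infDist_lt_iff hE).1 htx
      have hm : μ {y | infDist x E + dist x y < t} ≤ ENNReal.ofReal (K * (2 * t) ^ (n - b)) := by
        refine le_trans ?_ (hA e he (2 * t) (by linarith))
        rw [hμ, withDensity_apply _ (measurableSet_lt hmh measurable_const)]
        refine lintegral_mono_set fun y hy => ?_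
        have hy' : infDist x E + dist x y < t := hy
        rw [mem_ball]
        have := dist_triangle y x e
        rw [dist_comm y x] at this
        linarith
      refine (mul_le_mul_right hm _).trans (le_of_eq ?_)
      rw [← ENNReal.ofReal_mul (by positivity), ← ENNReal.ofReal_mul (by positivity)]
      congr 1
      rw [show -(a + b - n) - 1 = (-a - 1) + (n - b) by ring, Real.rpow_add ht,
        Real.mul_rpow (by norm_num) ht.le]
      ring
    · have : {y : EV n | infDist x E + dist x y < t} = ∅ := by
        ext y; simp only [mem_ofPred_eq, mem_empty_iff_false, iff_false, not_lt]
        have := dist_nonneg (x := x) (y := y); linarith [not_lt.1 htx]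
      rw [this]; simp
  have hI : Ioi (infDist x E) ⊆ Ioi 0 := fun t ht => hx.trans ht
  calc _ ≤ ENNReal.ofReal a * ∫⁻ t in Ioi (0 : ℝ), (Ioi (infDist x E)).indicator
        (fun t => ENNReal.ofReal (K * 2 ^ (n - b)) * ENNReal.ofReal (t ^ (-(a + b - n) - 1))) t := by
        gcongr ENNReal.ofReal a * ?_
        exact setLIntegral_mono' measurableSet_Ioi h1
    _ = _ := by
        rw [setLIntegral_indicator measurableSet_Ioi, inter_eq_self_of_subset_left hI,
          lintegral_const_mul' _ _ ENNReal.ofReal_ne_top, tail_integral hc hx,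
          ENNReal.ofReal_rpow_of_pos hx, ← ENNReal.ofReal_mul (by positivity),
          ← ENNReal.ofReal_mul (by positivity), ← ENNReal.ofReal_mul (by positivity)]
        congr 1
        rw [show (n : ℝ) - a - b = -(a + b - n) by ring]
        ring

lemma jensen {α : Type*} [MeasurableSpace α] (μ : Measure α) {H : α → ℝ≥0∞} (hH : AEMeasurable H μ)
    {θ : ℝ} (hθ : 1 ≤ θ) :
    (∫⁻ y, H y ∂μ) ^ θ ≤ μ univ ^ (θ - 1) * ∫⁻ y, H y ^ θ ∂μ := by
  rcases hθ.eq_or_lt with rfl | hθ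
  · simp
  have hc : θ.HolderConjugate (Real.conjExponent θ) := Real.HolderConjugate.conjExponent hθ
  have h := ENNReal.lintegral_mul_le_Lp_mul_Lq μ hc hH (aemeasurable_const (b := (1 : ℝ≥0∞)))
  simp only [Pi.mul_apply, mul_one, ENNReal.one_rpow, lintegral_one] at h
  have h0 : 0 < θ := by linarith
  calc (∫⁻ y, H y ∂μ) ^ θ ≤ ((∫⁻ y, H y ^ θ ∂μ) ^ (1 / θ) * μ univ ^ (1 / Real.conjExponent θ)) ^ θ :=
        ENNReal.rpow_le_rpow h h0.le
    _ = _ := by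
        rw [ENNReal.mul_rpow_of_nonneg _ _ h0.le, ← ENNReal.rpow_mul, ← ENNReal.rpow_mul,
          one_div_mul_cancel h0.ne', ENNReal.rpow_one, mul_comm]
        congr 2
        simp only [Real.conjExponent]
        field_simp

set_option maxHeartbeats 400000 in
lemma nonlocal {n : ℕ} {E : Set (EV n)} (hE : E.Nonempty) (hEc : IsClosed E) {s C : ℝ}
    (hs : 0 ≤ s) (hC : 1 ≤ C) (hcov : CovData E s C) (hsn : s < n) {p q β : ℝ} (hp : 1 < p)
    (hpq : p ≤ q) (h1 : s < q / p * (n - p + β)) (h2 : s < n - β / (p - 1)) :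
    ∃ K : ℝ, 0 < K ∧ ∀ g : EV n → ℝ≥0∞, Measurable g →
      ∫⁻ x, ENNReal.ofReal (infDist x E) ^ (q / p * (n - p + β) - n) *
        (∫⁻ y, ENNReal.ofReal (infDist x E + dist x y + infDist y E) ^ (-(n - 1 : ℝ)) * g y) ^ q ≤
      ENNReal.ofReal K * (∫⁻ x, g x ^ p * ENNReal.ofReal (infDist x E) ^ β) ^ (q / p) := by
  have hp0 : 0 < p := by linarith
  have hp1 : 0 < p - 1 := by linarith
  have hq0 : 0 < q := by linarith
  set κ := (n - p + β) / p with hκ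
  have hκq : q / p * (n - p + β) = κ * q := by rw [hκ]; field_simp
  rw [hκq] at h1 ⊢
  set γ := κ * q - n with hγ
  set p' := p / (p - 1) with hp'
  have hp'0 : 0 < p' := by positivity
  have hκ0 : 0 < κ := by
    have : 0 < κ * q := by linarith
    exact pos_of_mul_pos_left this hq0.le
  set a := n - 1 - κ with ha
  have hap' : a * p' = n - β / (p - 1) := by
    rw [ha, hp', hκ]; field_simp; ring
  have ha0 : 0 < a := by
    have : 0 < a * p' := by rw [hap']; linarith
    exact pos_of_mul_pos_left this hp'0.le
  obtain ⟨ε, hε0, hε1, hε2⟩ : ∃ ε : ℝ, 0 < ε ∧ ε * q < κ * q - s ∧ ε * p' < n - β / (p - 1) - s := by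
    refine ⟨min ((κ * q - s) / q) ((n - β / (p - 1) - s) / p') / 2, ?_, ?_, ?_⟩
    · have : 0 < (κ * q - s) / q := div_pos (by linarith) hq0
      have : 0 < (n - β / (p - 1) - s) / p' := div_pos (by linarith) hp'0
      positivity
    · have h3 : 0 < (κ * q - s) / q := div_pos (by linarith) hq0
      rw [← lt_div_iff₀ hq0]
      have := min_le_left ((κ * q - s) / q) ((n - β / (p - 1) - s) / p')
      linarith
    · have h3 : 0 < (n - β / (p - 1) - s) / p' := div_pos (by linarith) hp'0
      rw [← lt_div_iff₀ hp'0]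
      have := min_le_right ((κ * q - s) / q) ((n - β / (p - 1) - s) / p')
      linarith
  have hbb : (ε + β / p) * p' = ε * p' + β / (p - 1) := by rw [hp']; field_simp
  obtain ⟨K1, hK1, hk1⟩ := kernel_est hE hEc (a := a * p') (b := (ε + β / p) * p') hs hC hcov hsn
    (by rw [hbb]; linarith) (by positivity) (by rw [hbb, hap']; have := mul_pos hε0 hp'0; linarith)
  obtain ⟨K2, hK2, hk2⟩ := kernel_est hE hEc (a := κ * q) (b := ε * q - γ) hs hC hcov hsn
    (by rw [hγ]; linarith) (by positivity) (by rw [hγ]; have := mul_pos hε0 hq0; linarith)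
  refine ⟨K1 ^ (q / p') * K2, by positivity, fun g hg => ?_⟩
  have hae := ae_pos hE hEc (vol_E hC hcov hsn)
  have hmd : Measurable fun y : EV n => infDist y E := (continuous_infDist_pt E).measurable
  set d : EV n → ℝ≥0∞ := fun x => ENNReal.ofReal (infDist x E) with hd
  have hdm : Measurable d := by fun_prop
  set ρ : EV n → EV n → ℝ≥0∞ := fun x y => ENNReal.ofReal (infDist x E + dist x y + infDist y E) with hρ
  have hρm2 : Measurable (fun z : EV n × EV n => ρ z.1 z.2) := by
    refine ENNReal.measurable_ofReal.comp ?_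
    exact ((hmd.comp measurable_fst).add (measurable_fst.dist measurable_snd)).add
      (hmd.comp measurable_snd)
  have hρm : ∀ x, Measurable (ρ x) := fun x =>
    ENNReal.measurable_ofReal.comp ((measurable_const.add (measurable_const.dist measurable_id)).add hmd)
  have hdt : ∀ x, d x ≠ ∞ := fun x => ENNReal.ofReal_ne_top
  have hρt : ∀ x y, ρ x y ≠ ∞ := fun x y => ENNReal.ofReal_ne_top
  have hρsymm : ∀ x y, ρ x y = ρ y x := fun x y => by
    simp only [hρ]; rw [dist_comm]; congr 1; ring
  have hρ0 : ∀ x y, 0 < infDist x E → ρ x y ≠ 0 := fun x y hx => by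
    have := infDist_nonneg (x := y) (s := E)
    exact (ENNReal.ofReal_pos.2 (by positivity)).ne'
  set ν := (volume : Measure (EV n)).withDensity (fun y => g y ^ p * d y ^ β) with hν
  have hwm : Measurable (fun y => g y ^ p * d y ^ β) := by fun_prop
  have hνu : ν univ = ∫⁻ x, g x ^ p * d x ^ β := by rw [hν, withDensity_apply _ MeasurableSet.univ]; simp
  rw [← hνu]
  have hρle : ∀ x y (t : ℝ), 0 ≤ t → ρ x y ^ (-t) ≤
      ENNReal.ofReal (infDist x E + dist x y) ^ (-t) := by
    intro x y t ht
    rw [ENNReal.rpow_neg, ENNReal.rpow_neg, ENNReal.inv_le_inv]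
    refine ENNReal.rpow_le_rpow (ENNReal.ofReal_le_ofReal ?_) ht
    have := infDist_nonneg (x := y) (s := E)
    linarith
  have hconj : p.HolderConjugate p' := Real.HolderConjugate.conjExponent hp
  have hpt : ∀ x, 0 < infDist x E → (∫⁻ y, ρ x y ^ (-(n - 1 : ℝ)) * g y) ^ q ≤
      ENNReal.ofReal (K1 ^ (q / p')) * d x ^ (-(ε * q)) *
        (ν univ ^ (q / p - 1) * ∫⁻ y, ρ x y ^ (-(κ * q)) * d y ^ (ε * q) ∂ν) := by
    intro x hx
    have e1 : ∫⁻ y, ρ x y ^ (-(n - 1 : ℝ)) * g y = ∫⁻ y, (ρ x y ^ (-a) * d y ^ (-(ε + β / p))) *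
        (ρ x y ^ (-κ) * d y ^ (ε + β / p) * g y) := by
      refine lintegral_congr_ae ?_
      filter_upwards [hae] with y hy
      have hdy : d y ≠ 0 := (ENNReal.ofReal_pos.2 hy).ne'
      have : ρ x y ^ (-(n - 1 : ℝ)) = ρ x y ^ (-a) * ρ x y ^ (-κ) := by
        rw [← ENNReal.rpow_add _ _ (hρ0 x y hx) (hρt x y)]; congr 1; rw [ha]; ring
      rw [this]
      have h1 : d y ^ (-(ε + β / p)) * d y ^ (ε + β / p) = 1 := by
        rw [← ENNReal.rpow_add _ _ hdy (hdt y)]; simp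
      calc _ = ρ x y ^ (-a) * ρ x y ^ (-κ) * g y * (d y ^ (-(ε + β / p)) * d y ^ (ε + β / p)) := by
            rw [h1, mul_one]
        _ = _ := by ring
    have hm1 : Measurable (fun y => ρ x y ^ (-a) * d y ^ (-(ε + β / p))) :=
      ((hρm x).pow_const _).mul (hdm.pow_const _)
    have hm2 : Measurable (fun y => ρ x y ^ (-κ) * d y ^ (ε + β / p) * g y) :=
      (((hρm x).pow_const _).mul (hdm.pow_const _)).mul hg
    have e2 := ENNReal.lintegral_mul_le_Lp_mul_Lq volume hconj.symm hm1.aemeasurable hm2.aemeasurable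
    have e3 : ∫⁻ y, (ρ x y ^ (-a) * d y ^ (-(ε + β / p))) ^ p' ≤
        ENNReal.ofReal K1 * d x ^ (-(ε * p')) := by
      calc _ ≤ ∫⁻ y, ENNReal.ofReal (infDist x E + dist x y) ^ (-(a * p')) *
              d y ^ (-((ε + β / p) * p')) := by
            refine lintegral_mono fun y => ?_
            rw [ENNReal.mul_rpow_of_nonneg _ _ hp'0.le, ← ENNReal.rpow_mul, ← ENNReal.rpow_mul,
              neg_mul, neg_mul]
            exact mul_le_mul_left (hρle x y _ (by positivity)) _
        _ ≤ _ := hk1 x hx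
        _ = _ := by
            congr 2
            rw [hbb, hap']; ring
    have e4 : ∫⁻ y, (ρ x y ^ (-κ) * d y ^ (ε + β / p) * g y) ^ p =
        ∫⁻ y, ρ x y ^ (-(κ * p)) * d y ^ (ε * p) ∂ν := by
      have hm3 : Measurable (fun y => ρ x y ^ (-(κ * p)) * d y ^ (ε * p)) :=
        ((hρm x).pow_const _).mul (hdm.pow_const _)
      rw [hν, lintegral_withDensity_eq_lintegral_mul _ hwm hm3]
      refine lintegral_congr_ae ?_
      filter_upwards [hae] with y hy
      have hdy : d y ≠ 0 := (ENNReal.ofReal_pos.2 hy).ne'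
      simp only [Pi.mul_apply]
      rw [ENNReal.mul_rpow_of_nonneg _ _ hp0.le, ENNReal.mul_rpow_of_nonneg _ _ hp0.le,
        ← ENNReal.rpow_mul, ← ENNReal.rpow_mul, neg_mul,
        show (ε + β / p) * p = ε * p + β by field_simp, ENNReal.rpow_add _ _ hdy (hdt y)]
      ring
    have e5 := jensen ν (H := fun y => ρ x y ^ (-(κ * p)) * d y ^ (ε * p))
      (((hρm x).pow_const _).mul (hdm.pow_const _)).aemeasurable (θ := q / p)
      (by rw [le_div_iff₀ hp0]; linarith)
    have e6 : ∀ y, (ρ x y ^ (-(κ * p)) * d y ^ (ε * p)) ^ (q / p) = ρ x y ^ (-(κ * q)) * d y ^ (ε * q) := by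
      intro y
      rw [ENNReal.mul_rpow_of_nonneg _ _ (by positivity), ← ENNReal.rpow_mul, ← ENNReal.rpow_mul]
      congr 2 <;> field_simp
    simp only [e6] at e5
    calc (∫⁻ y, ρ x y ^ (-(n - 1 : ℝ)) * g y) ^ q
        ≤ ((ENNReal.ofReal K1 * d x ^ (-(ε * p'))) ^ (1 / p') *
          (∫⁻ y, ρ x y ^ (-(κ * p)) * d y ^ (ε * p) ∂ν) ^ (1 / p)) ^ q := by
          refine ENNReal.rpow_le_rpow ?_ hq0.le
          rw [e1]
          refine e2.trans ?_
          rw [e4]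
          gcongr
      _ = ENNReal.ofReal (K1 ^ (q / p')) * d x ^ (-(ε * q)) *
          (∫⁻ y, ρ x y ^ (-(κ * p)) * d y ^ (ε * p) ∂ν) ^ (q / p) := by
          rw [ENNReal.mul_rpow_of_nonneg _ _ hq0.le, ← ENNReal.rpow_mul, ← ENNReal.rpow_mul,
            ENNReal.mul_rpow_of_nonneg _ _ (by positivity), ← ENNReal.rpow_mul,
            ENNReal.ofReal_rpow_of_pos hK1]
          have x1 : 1 / p' * q = q / p' := by ring
          have x2 : -(ε * p') * (1 / p' * q) = -(ε * q) := by field_simp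
          have x3 : 1 / p * q = q / p := by ring
          rw [x2, x1, x3]
      _ ≤ _ := by gcongr
  have hK : (0:ℝ) ≤ K1 ^ (q / p') := by positivity
  by_cases hN : ν univ = ∞
  · rw [hN, ENNReal.top_rpow_of_pos (by positivity), ENNReal.mul_top]
    · exact le_top
    · exact (ENNReal.ofReal_pos.2 (by positivity)).ne'
  have : SFinite ν := by rw [hν]; infer_instance
  have hNp : ν univ ^ (q / p - 1) ≠ ∞ :=
    ENNReal.rpow_ne_top_of_nonneg (by rw [sub_nonneg, le_div_iff₀ hp0]; linarith) hN
  have hmj : Measurable (fun z : EV n × EV n =>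
      d z.1 ^ (γ - ε * q) * (ρ z.1 z.2 ^ (-(κ * q)) * d z.2 ^ (ε * q))) :=
    ((hdm.comp measurable_fst).pow_const _).mul
      ((hρm2.pow_const _).mul ((hdm.comp measurable_snd).pow_const _))
  calc ∫⁻ x, d x ^ γ * (∫⁻ y, ρ x y ^ (-(n - 1 : ℝ)) * g y) ^ q
      ≤ ∫⁻ x, (ENNReal.ofReal (K1 ^ (q / p')) * ν univ ^ (q / p - 1)) *
          ∫⁻ y, d x ^ (γ - ε * q) * (ρ x y ^ (-(κ * q)) * d y ^ (ε * q)) ∂ν := by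
        refine lintegral_mono_ae ?_
        filter_upwards [hae] with x hx
        have hdx : d x ≠ 0 := (ENNReal.ofReal_pos.2 hx).ne'
        refine (mul_le_mul_right (hpt x hx) _).trans (le_of_eq ?_)
        rw [lintegral_const_mul' _ _ (ENNReal.rpow_ne_top_of_ne_zero hdx (hdt x)),
          sub_eq_add_neg γ, ENNReal.rpow_add _ _ hdx (hdt x)]
        ring
    _ = (ENNReal.ofReal (K1 ^ (q / p')) * ν univ ^ (q / p - 1)) *
          ∫⁻ y, ∫⁻ x, d x ^ (γ - ε * q) * (ρ x y ^ (-(κ * q)) * d y ^ (ε * q)) ∂volume ∂ν := by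
        rw [lintegral_const_mul' _ _ (ENNReal.mul_ne_top ENNReal.ofReal_ne_top hNp),
          lintegral_lintegral_swap hmj.aemeasurable]
    _ ≤ (ENNReal.ofReal (K1 ^ (q / p')) * ν univ ^ (q / p - 1)) * ∫⁻ y, ENNReal.ofReal K2 ∂ν := by
        gcongr _ * ?_
        refine lintegral_mono_ae ?_
        have hae' : ∀ᵐ y ∂ν, 0 < infDist y E := (withDensity_absolutelyContinuous _ _).ae_le hae
        filter_upwards [hae'] with y hy
        have hdy : d y ≠ 0 := (ENNReal.ofReal_pos.2 hy).ne'
        calc ∫⁻ x, d x ^ (γ - ε * q) * (ρ x y ^ (-(κ * q)) * d y ^ (ε * q))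
            ≤ ∫⁻ x, d y ^ (ε * q) * (ENNReal.ofReal (infDist y E + dist y x) ^ (-(κ * q)) *
                d x ^ (-(ε * q - γ))) := by
              refine lintegral_mono fun x => ?_
              rw [hρsymm x y, neg_sub, mul_comm, mul_comm (ρ y x ^ _), mul_assoc]
              refine mul_le_mul_right ?_ _
              exact mul_le_mul_left (hρle y x _ (by positivity)) _
          _ = d y ^ (ε * q) * ∫⁻ x, (ENNReal.ofReal (infDist y E + dist y x) ^ (-(κ * q)) *
                d x ^ (-(ε * q - γ))) :=
              lintegral_const_mul' _ _ (ENNReal.rpow_ne_top_of_ne_zero hdy (hdt y))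
          _ ≤ d y ^ (ε * q) * (ENNReal.ofReal K2 * d y ^ (n - κ * q - (ε * q - γ))) := by
              gcongr; exact hk2 y hy
          _ = ENNReal.ofReal K2 * (d y ^ (ε * q) * d y ^ (n - κ * q - (ε * q - γ))) := by ring
          _ = ENNReal.ofReal K2 := by
              rw [← ENNReal.rpow_add _ _ hdy (hdt y),
                show ε * q + (n - κ * q - (ε * q - γ)) = 0 by rw [hγ]; ring, ENNReal.rpow_zero, mul_one]
    _ = ENNReal.ofReal (K1 ^ (q / p') * K2) * (ν univ ^ (q / p - 1) * ν univ ^ (1 : ℝ)) := by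
        rw [lintegral_const, ENNReal.ofReal_mul hK, ENNReal.rpow_one]; ring
    _ = _ := by
        rw [← ENNReal.rpow_add_of_nonneg _ _ (by rw [sub_nonneg, le_div_iff₀ hp0]; linarith) zero_le_one]
        congr 2; ring

lemma seg_bound {n : ℕ} {f : EV n → ℝ} (hf : ContDiff ℝ 1 f) (z w : EV n) {a b : ℝ} (hab : a ≤ b) :
    ‖f (z + a • w)‖ₑ ≤ ‖f (z + b • w)‖ₑ + ‖w‖ₑ * ∫⁻ t in Ioc a b, ‖fderiv ℝ f (z + t • w)‖ₑ := by
  have hd : ∀ t : ℝ, HasDerivAt (fun t : ℝ => f (z + t • w)) (fderiv ℝ f (z + t • w) w) t := by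
    intro t
    have h1 : HasDerivAt (fun t : ℝ => z + t • w) w t := by
      simpa using ((hasDerivAt_id t).smul_const w).const_add z
    have h2 := (hf.differentiable one_ne_zero (z + t • w)).hasFDerivAt
    exact h2.comp_hasDerivAt t h1
  have hc : Continuous (fun t : ℝ => fderiv ℝ f (z + t • w) w) := by
    have := hf.continuous_fderiv one_ne_zero
    fun_prop
  have hftc := intervalIntegral.integral_eq_sub_of_hasDerivAt (a := a) (b := b) (fun t _ => hd t)
    (hc.intervalIntegrable _ _)
  have e : f (z + a • w) = f (z + b • w) - ∫ t in a..b, fderiv ℝ f (z + t • w) w := by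
    rw [hftc]; ring
  rw [e]
  refine (enorm_sub_le).trans (add_le_add le_rfl ?_)
  rw [intervalIntegral.integral_of_le hab]
  refine (enorm_integral_le_lintegral_enorm _).trans ?_
  rw [← lintegral_const_mul' _ _ enorm_ne_top]
  refine lintegral_mono fun t => ?_
  rw [mul_comm]
  exact ContinuousLinearMap.le_opENorm _ _

lemma ray_bound {n : ℕ} {f : EV n → ℝ} (hf : ContDiff ℝ 1 f) (hfc : HasCompactSupport f)
    (z w : EV n) (hw : w ≠ 0) (hw1 : ‖w‖ ≤ 1) (r : ℝ) :
    ‖f (z + r • w)‖ₑ ≤ ∫⁻ t in Ioi r, ‖fderiv ℝ f (z + t • w)‖ₑ := by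
  obtain ⟨R, hR⟩ := hfc.isCompact.isBounded.subset_closedBall 0
  have hwp : 0 < ‖w‖ := norm_pos_iff.2 hw
  set T := max r ((R + ‖z‖ + 1) / ‖w‖) with hT
  have hfT : f (z + T • w) = 0 := by
    by_contra hne
    have h1 : z + T • w ∈ tsupport f := subset_tsupport f hne
    have h2 := hR h1
    rw [mem_closedBall_zero_iff] at h2
    have h3 : ‖T • w‖ - ‖z‖ ≤ ‖z + T • w‖ := by
      have := norm_sub_le (z + T • w) z
      rw [add_sub_cancel_left] at this; linarith
    have h4 : R + ‖z‖ + 1 ≤ T * ‖w‖ := by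
      rw [← div_le_iff₀ hwp]; exact le_max_right _ _
    have h5 : T * ‖w‖ ≤ ‖T • w‖ := by
      rw [norm_smul]; exact mul_le_mul_of_nonneg_right (le_abs_self T) hwp.le
    linarith
  have h := seg_bound hf z w (le_max_left r ((R + ‖z‖ + 1) / ‖w‖))
  rw [← hT, hfT, enorm_zero, zero_add] at h
  refine h.trans ?_
  have hw2 : ‖w‖ₑ ≤ 1 := by
    rw [← ofReal_norm]; simpa using ENNReal.ofReal_le_ofReal hw1
  calc _ ≤ 1 * ∫⁻ t in Ioc r T, ‖fderiv ℝ f (z + t • w)‖ₑ := by gcongr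
    _ ≤ _ := by rw [one_mul]; exact lintegral_mono_set Ioc_subset_Ioi_self

lemma avg_bound {n : ℕ} (hn : 2 ≤ n) {f : EV n → ℝ} (hf : ContDiff ℝ 1 f) (hfc : HasCompactSupport f)
    (z : EV n) {r : ℝ} (hr : 0 < r) :
    ∫⁻ w in ball (0 : EV n) 1, ‖f (z + r • w)‖ₑ ≤
      ∫⁻ y, ENNReal.ofReal (max r (dist z y)) ^ (-(n - 1 : ℝ)) * ‖fderiv ℝ f y‖ₑ := by
  have hn1 : (1 : ℝ) ≤ n - 1 := by
    have : (2 : ℝ) ≤ n := by exact_mod_cast hn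
    linarith
  have : Nonempty (Fin n) := ⟨⟨0, by omega⟩⟩
  have hgc : Continuous (fun y => fderiv ℝ f y) := hf.continuous_fderiv one_ne_zero
  have hgm : Measurable (fun y => ‖fderiv ℝ f y‖ₑ) := hgc.enorm.measurable
  set μ := (volume : Measure (EV n)).withDensity (fun y => ‖fderiv ℝ f y‖ₑ) with hμ
  have hmh : Measurable fun y : EV n => max r (dist z y) := by fun_prop
  have e1 : ∫⁻ y, ENNReal.ofReal (max r (dist z y)) ^ (-(n - 1 : ℝ)) * ‖fderiv ℝ f y‖ₑ =
      ∫⁻ y, ENNReal.ofReal (max r (dist z y)) ^ (-(n - 1 : ℝ)) ∂μ := by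
    rw [hμ, lintegral_withDensity_eq_lintegral_mul _ hgm (by fun_prop)]
    simp only [Pi.mul_apply, mul_comm]
  rw [e1, layer μ hmh (Filter.Eventually.of_forall fun y => lt_max_of_lt_left hr) (by linarith)]
  have hcc : Continuous (fun q : EV n × ℝ => ‖fderiv ℝ f (z + q.2 • q.1)‖ₑ) :=
    (hgc.comp (by fun_prop)).enorm
  calc ∫⁻ w in ball (0 : EV n) 1, ‖f (z + r • w)‖ₑ
      ≤ ∫⁻ w in ball (0 : EV n) 1, ∫⁻ t in Ioi r, ‖fderiv ℝ f (z + t • w)‖ₑ := by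
        refine lintegral_mono_ae ?_
        have h0 : ∀ᵐ w : EV n, w ≠ 0 := by
          have : (volume : Measure (EV n)) {0} = 0 := measure_singleton _
          exact measure_eq_zero_iff_ae_notMem.1 this
        filter_upwards [ae_restrict_of_ae h0, ae_restrict_mem measurableSet_ball] with w hw hwb
        exact ray_bound hf hfc z w hw (mem_ball_zero_iff.1 hwb).le r
    _ = ∫⁻ t in Ioi r, ∫⁻ w in ball (0 : EV n) 1, ‖fderiv ℝ f (z + t • w)‖ₑ :=
        lintegral_lintegral_swap hcc.measurable.aemeasurable
    _ ≤ ∫⁻ t in Ioi r, ENNReal.ofReal (t ^ (-(n - 1 : ℝ) - 1)) * μ {y | max r (dist z y) < t} := by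
        refine setLIntegral_mono' measurableSet_Ioi fun t ht => ?_
        have ht0 : 0 < t := hr.trans ht
        rw [scale_setLIntegral (fun x => ‖fderiv ℝ f x‖ₑ) z ht0, mul_one]
        refine le_of_eq ?_
        have : {y : EV n | max r (dist z y) < t} = ball z t := by
          ext y; simp only [mem_ofPred_eq, max_lt_iff, mem_ball, dist_comm y z]
          exact ⟨fun h => h.2, fun h => ⟨ht, h⟩⟩
        rw [this, hμ, withDensity_apply _ measurableSet_ball]
        congr 2
        rw [show -(n - 1 : ℝ) - 1 = -(n : ℝ) by ring, Real.rpow_neg ht0.le, Real.rpow_natCast]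
    _ ≤ ∫⁻ t in Ioi (0 : ℝ), ENNReal.ofReal (t ^ (-(n - 1 : ℝ) - 1)) * μ {y | max r (dist z y) < t} :=
        lintegral_mono_set (Ioi_subset_Ioi hr.le)
    _ ≤ _ := by
        refine le_mul_of_one_le_left (zero_le) ?_
        simpa using ENNReal.ofReal_le_ofReal hn1

lemma swap_bound {n : ℕ} {H : EV n → ℝ≥0∞} (hH : Measurable H) {t : ℝ} (ht0 : 0 < t) (ht1 : t ≤ 1) :
    ∫⁻ x in ball (0 : EV n) 2, ∫⁻ y in ball (0 : EV n) 2, H (x + t • (y - x)) ≤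
      ENNReal.ofReal (2 ^ n) * (∫⁻ x, H x) * volume (ball (0 : EV n) 2) := by
  have key : ∀ (c : EV n) (r : ℝ), 1 / 2 ≤ r →
      ∫⁻ w in ball (0 : EV n) 2, H (c + r • w) ≤ ENNReal.ofReal (2 ^ n) * ∫⁻ x, H x := by
    intro c r hr
    have hr0 : 0 < r := by linarith
    refine (setLIntegral_le_lintegral _ _).trans ?_
    rw [scale_lintegral H c hr0]
    refine mul_le_mul_left (ENNReal.ofReal_le_ofReal ?_) _
    rw [← inv_pow]
    refine pow_le_pow_left₀ (by positivity) ?_ n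
    rw [inv_le_comm₀ hr0 (by norm_num)]; linarith
  have hm : Measurable (fun q : EV n × EV n => H (q.1 + t • (q.2 - q.1))) := hH.comp (by fun_prop)
  rcases le_total (1 / 2) t with h | h
  · calc _ ≤ ∫⁻ x in ball (0 : EV n) 2, ENNReal.ofReal (2 ^ n) * ∫⁻ x, H x := by
          refine lintegral_mono fun x => ?_
          have := key (x - t • x) t h
          refine le_trans (le_of_eq ?_) this
          congr 1; ext y; congr 1; rw [smul_sub]; abel
      _ = _ := by rw [setLIntegral_const]
  · rw [lintegral_lintegral_swap hm.aemeasurable]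
    calc _ ≤ ∫⁻ y in ball (0 : EV n) 2, ENNReal.ofReal (2 ^ n) * ∫⁻ x, H x := by
          refine lintegral_mono fun y => ?_
          have := key (t • y) (1 - t) (by linarith)
          refine le_trans (le_of_eq ?_) this
          congr 1; ext x; congr 1; rw [smul_sub, sub_smul, one_smul]; abel
      _ = _ := by rw [setLIntegral_const]

lemma poincare {n : ℕ} {p : ℝ} (hp : 1 ≤ p) :
    ∃ K : ℝ≥0∞, K ≠ ∞ ∧ ∀ f : EV n → ℝ, ContDiff ℝ 1 f →
      ∫⁻ x in ball (0 : EV n) 2, ‖f x‖ₑ ^ p ≤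
        K * ((∫⁻ x in ball (0 : EV n) 2, ‖fderiv ℝ f x‖ₑ ^ p) +
          (∫⁻ x in ball (0 : EV n) 2, ‖f x‖ₑ) ^ p) := by
  have hp0 : 0 ≤ p := by linarith
  set B := ball (0 : EV n) 2 with hB
  set v := volume B with hv
  have hv0 : v ≠ 0 := (measure_ball_pos volume _ (by norm_num)).ne'
  have hvt : v ≠ ∞ := measure_ball_lt_top.ne
  set M := ((volume : Measure (EV n)).restrict B).prod ((volume : Measure ℝ).restrict (Ioc 0 1)) with hM
  have hMt : M univ ≠ ∞ := by
    have : IsFiniteMeasure ((volume : Measure (EV n)).restrict B) := ⟨by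
      rw [Measure.restrict_apply_univ]; exact hvt.lt_top⟩
    exact measure_ne_top M univ
  set K1 : ℝ≥0∞ := 2 ^ (p - 1) * v with hK1
  set K2 : ℝ≥0∞ := 2 ^ (p - 1) * (4 ^ p * (M univ ^ (p - 1) * (ENNReal.ofReal (2 ^ n) * v))) with hK2
  have hK1t : K1 ≠ ∞ := ENNReal.mul_ne_top (ENNReal.rpow_ne_top_of_nonneg (by linarith) (by simp)) hvt
  have hK2t : K2 ≠ ∞ := by
    refine ENNReal.mul_ne_top (ENNReal.rpow_ne_top_of_nonneg (by linarith) (by simp)) ?_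
    refine ENNReal.mul_ne_top (ENNReal.rpow_ne_top_of_nonneg (by linarith) (by simp)) ?_
    refine ENNReal.mul_ne_top (ENNReal.rpow_ne_top_of_nonneg (by linarith) hMt) ?_
    exact ENNReal.mul_ne_top ENNReal.ofReal_ne_top hvt
  have hvp0 : v ^ p ≠ 0 := (ENNReal.rpow_pos (pos_iff_ne_zero.2 hv0) hvt).ne'
  have hvpt : v ^ p ≠ ∞ := ENNReal.rpow_ne_top_of_nonneg hp0 hvt
  refine ⟨(v ^ p)⁻¹ * (K1 + K2), ENNReal.mul_ne_top (ENNReal.inv_ne_top.2 hvp0)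
    (ENNReal.add_ne_top.2 ⟨hK1t, hK2t⟩), fun f hf => ?_⟩
  have hgc : Continuous (fun y => fderiv ℝ f y) := hf.continuous_fderiv one_ne_zero
  have hgm : Measurable (fun y => ‖fderiv ℝ f y‖ₑ) := hgc.enorm.measurable
  have hfm : Measurable (fun y => ‖f y‖ₑ) := hf.continuous.enorm.measurable
  obtain ⟨G, hG⟩ : ∃ G : EV n → ℝ≥0∞, G = B.indicator (fun y => ‖fderiv ℝ f y‖ₑ) := ⟨_, rfl⟩
  have hGm : Measurable G := by rw [hG]; exact hgm.indicator measurableSet_ball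
  have hGp : ∫⁻ x, G x ^ p = ∫⁻ x in B, ‖fderiv ℝ f x‖ₑ ^ p := by
    rw [← lintegral_indicator (show MeasurableSet B from measurableSet_ball)]
    congr 1; ext x; rw [hG]; by_cases hx : x ∈ B
    · simp [hx]
    · simp [hx, show 0 < p by linarith]
  have hpt : ∀ x ∈ B, v * ‖f x‖ₑ ≤ (∫⁻ y in B, ‖f y‖ₑ) + 4 * ∫⁻ m, G (x + m.2 • (m.1 - x)) ∂M := by
    intro x hx
    have hmm : Measurable (fun m : EV n × ℝ => G (x + m.2 • (m.1 - x))) := hGm.comp (by fun_prop)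
    rw [hM, lintegral_prod _ hmm.aemeasurable, ← lintegral_const_mul _ hmm.lintegral_prod_right',
      ← lintegral_add_left hfm, mul_comm, hv, ← setLIntegral_const]
    refine setLIntegral_mono' measurableSet_ball fun y hy => ?_
    have h := seg_bound hf x (y - x) (zero_le_one)
    rw [zero_smul, add_zero, one_smul, add_sub_cancel] at h
    refine h.trans (add_le_add_right ?_ _)
    refine mul_le_mul' ?_ ?_
    · rw [← ofReal_norm]
      have h1 : ‖y - x‖ ≤ 4 := by
        have := norm_sub_le y x
        rw [hB, mem_ball_zero_iff] at hx hy; linarith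
      simpa using ENNReal.ofReal_le_ofReal h1
    · refine setLIntegral_mono' measurableSet_Ioc fun t ht => ?_
      have : x + t • (y - x) ∈ B := (convex_ball (0 : EV n) 2).add_smul_sub_mem hx hy ⟨ht.1.le, ht.2⟩
      rw [hG]; simp [this]
  have hpt2 : ∀ x ∈ B, v ^ p * ‖f x‖ₑ ^ p ≤ 2 ^ (p - 1) * ((∫⁻ y in B, ‖f y‖ₑ) ^ p) +
      2 ^ (p - 1) * (4 ^ p * (M univ ^ (p - 1) * ∫⁻ m, G (x + m.2 • (m.1 - x)) ^ p ∂M)) := by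
    intro x hx
    have hmm : Measurable (fun m : EV n × ℝ => G (x + m.2 • (m.1 - x))) := hGm.comp (by fun_prop)
    rw [← ENNReal.mul_rpow_of_nonneg _ _ hp0, ← mul_add]
    refine (ENNReal.rpow_le_rpow (hpt x hx) hp0).trans ?_
    refine (ENNReal.rpow_add_le_mul_rpow_add_rpow _ _ hp).trans ?_
    refine mul_le_mul_right (add_le_add_right ?_ _) _
    rw [ENNReal.mul_rpow_of_nonneg _ _ hp0]
    exact mul_le_mul_right (jensen M hmm.aemeasurable hp) _
  have hm3 : Measurable (fun q : EV n × (EV n × ℝ) => G (q.1 + q.2.2 • (q.2.1 - q.1)) ^ p) :=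
    (hGm.comp (by fun_prop)).pow_const p
  have hm3' : Measurable (fun x => ∫⁻ m, G (x + m.2 • (m.1 - x)) ^ p ∂M) := hm3.lintegral_prod_right'
  have hI : ∫⁻ x in B, ∫⁻ m, G (x + m.2 • (m.1 - x)) ^ p ∂M ≤
      ENNReal.ofReal (2 ^ n) * v * ∫⁻ x in B, ‖fderiv ℝ f x‖ₑ ^ p := by
    have e1 : ∀ x, ∫⁻ m, G (x + m.2 • (m.1 - x)) ^ p ∂M =
        ∫⁻ t in Ioc (0 : ℝ) 1, ∫⁻ y in B, G (x + t • (y - x)) ^ p := by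
      intro x
      have hmm : Measurable (fun m : EV n × ℝ => G (x + m.2 • (m.1 - x)) ^ p) :=
        (hGm.comp (by fun_prop)).pow_const p
      rw [hM, lintegral_prod_symm _ hmm.aemeasurable]
    have hm4 : Measurable (fun q : (EV n × ℝ) × EV n => G (q.1.1 + q.1.2 • (q.2 - q.1.1)) ^ p) :=
      (hGm.comp (by fun_prop)).pow_const p
    have hm5 : Measurable (fun q : EV n × ℝ => ∫⁻ y in B, G (q.1 + q.2 • (y - q.1)) ^ p) :=
      hm4.lintegral_prod_right'
    simp only [e1]
    rw [lintegral_lintegral_swap hm5.aemeasurable]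
    calc _ ≤ ∫⁻ t in Ioc (0 : ℝ) 1, ENNReal.ofReal (2 ^ n) * (∫⁻ x, G x ^ p) * v :=
          setLIntegral_mono' measurableSet_Ioc fun t ht => swap_bound (hGm.pow_const p) ht.1 ht.2
      _ = _ := by
          rw [setLIntegral_const, Real.volume_Ioc, hGp]; simp; ring
  have hfin : v ^ p * ∫⁻ x in B, ‖f x‖ₑ ^ p ≤ (K1 + K2) *
      ((∫⁻ x in B, ‖fderiv ℝ f x‖ₑ ^ p) + (∫⁻ x in B, ‖f x‖ₑ) ^ p) := by
    rw [← lintegral_const_mul _ (hfm.pow_const p)]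
    calc _ ≤ ∫⁻ x in B, (2 ^ (p - 1) * ((∫⁻ y in B, ‖f y‖ₑ) ^ p) +
      2 ^ (p - 1) * (4 ^ p * (M univ ^ (p - 1) * ∫⁻ m, G (x + m.2 • (m.1 - x)) ^ p ∂M))) :=
          setLIntegral_mono' measurableSet_ball hpt2
      _ = K1 * (∫⁻ y in B, ‖f y‖ₑ) ^ p + 2 ^ (p - 1) * (4 ^ p * (M univ ^ (p - 1) *
            ∫⁻ x in B, ∫⁻ m, G (x + m.2 • (m.1 - x)) ^ p ∂M)) := by
          rw [lintegral_add_left measurable_const, setLIntegral_const,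
            lintegral_const_mul _ ((hm3'.const_mul _).const_mul _),
            lintegral_const_mul _ (hm3'.const_mul _), lintegral_const_mul _ hm3', hK1]
          congr 1; rw [← hv]; ring
      _ ≤ K1 * (∫⁻ y in B, ‖f y‖ₑ) ^ p + 2 ^ (p - 1) * (4 ^ p * (M univ ^ (p - 1) *
            (ENNReal.ofReal (2 ^ n) * v * ∫⁻ x in B, ‖fderiv ℝ f x‖ₑ ^ p))) := by
          exact add_le_add_right (mul_le_mul_right (mul_le_mul_right (mul_le_mul_right hI _) _) _) _
      _ = K1 * (∫⁻ y in B, ‖f y‖ₑ) ^ p + K2 * ∫⁻ x in B, ‖fderiv ℝ f x‖ₑ ^ p := by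
          rw [hK2]; ring
      _ ≤ _ := by
          rw [mul_add, add_comm]
          exact add_le_add (mul_le_mul_left (le_add_left le_rfl) _) (mul_le_mul_left (le_add_right le_rfl) _)
  rw [mul_assoc, ← ENNReal.mul_le_iff_le_inv hvp0 hvpt]
  exact hfin

lemma localSob {n : ℕ} (hn : 2 ≤ n) {p q : ℝ} (hp : 1 < p) (hpq : p ≤ q) (hpn : p < n)
    (hq : q ≤ n * p / (n - p)) :
    ∃ K : ℝ≥0∞, K ≠ ∞ ∧ ∀ f : EV n → ℝ, ContDiff ℝ 1 f →
      ∫⁻ x in ball (0 : EV n) 1, ‖f x‖ₑ ^ q ≤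
        K * ((∫⁻ x in ball (0 : EV n) 2, ‖fderiv ℝ f x‖ₑ ^ p) ^ (q / p) +
          (∫⁻ x in ball (0 : EV n) 2, ‖f x‖ₑ) ^ q) := by
  have hp0 : 0 < p := by linarith
  have hq0 : 0 < q := by linarith
  have hn0 : (0 : ℝ) < n := by linarith
  have hqp : 1 ≤ q / p := by rwa [le_div_iff₀ hp0, one_mul]
  have hqp0 : 0 ≤ q / p := by linarith
  obtain ⟨KP, hKPt, hKP⟩ := poincare (n := n) hp.le
  set B := ball (0 : EV n) 2 with hB
  let φ : ContDiffBump (0 : EV n) := ⟨1, 3 / 2, by norm_num, by norm_num⟩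
  have hφ : ContDiff ℝ 1 (φ : EV n → ℝ) := φ.contDiff
  have hφc : HasCompactSupport (φ : EV n → ℝ) := φ.hasCompactSupport
  obtain ⟨M, hM⟩ := (hφ.continuous_fderiv one_ne_zero).bounded_above_of_compact_support
    (hφc.fderiv ℝ)
  obtain ⟨P, hP⟩ : ∃ P : ℝ≥0, (P : ℝ) = p := ⟨⟨p, hp0.le⟩, rfl⟩
  obtain ⟨Q, hQ⟩ : ∃ Q : ℝ≥0, (Q : ℝ) = q := ⟨⟨q, hq0.le⟩, rfl⟩
  have hP0 : P ≠ 0 := by rintro rfl; simp at hP; linarith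
  have hQ0 : Q ≠ 0 := by rintro rfl; simp at hQ; linarith
  set S : ℝ≥0∞ := (eLpNormLESNormFDerivOfLeConst ℝ (volume : Measure (EV n)) (closedBall (0 : EV n) (3 / 2)) P Q : ℝ≥0∞) with hS
  set m : ℝ≥0∞ := ENNReal.ofReal M with hm
  have hfin : Module.finrank ℝ (EV n) = n := by simp
  set K3 : ℝ≥0∞ := 2 ^ (p - 1) * (1 + m ^ p * KP) with hK3
  have hK3t : K3 ≠ ∞ := by
    refine ENNReal.mul_ne_top (ENNReal.rpow_ne_top_of_nonneg (by linarith) (by simp)) ?_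
    refine ENNReal.add_ne_top.2 ⟨by simp, ENNReal.mul_ne_top (ENNReal.rpow_ne_top_of_nonneg hp0.le ENNReal.ofReal_ne_top) hKPt⟩
  refine ⟨S ^ q * (K3 ^ (q / p) * 2 ^ (q / p - 1)), ?_, fun f hf => ?_⟩
  · refine ENNReal.mul_ne_top (ENNReal.rpow_ne_top_of_nonneg hq0.le ENNReal.coe_ne_top) ?_
    exact ENNReal.mul_ne_top (ENNReal.rpow_ne_top_of_nonneg hqp0 hK3t)
      (ENNReal.rpow_ne_top_of_nonneg (by linarith) (by simp))
  have hgm : Measurable (fun y => ‖fderiv ℝ f y‖ₑ) := (hf.continuous_fderiv one_ne_zero).enorm.measurable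
  have hfm : Measurable (fun y => ‖f y‖ₑ) := hf.continuous.enorm.measurable
  set u : EV n → ℝ := fun x => φ x * f x with hu
  have huC : ContDiff ℝ 1 u := hφ.mul hf
  have hus : Function.support u ⊆ closedBall (0 : EV n) (3 / 2) := by
    intro x hx
    have : x ∈ Function.support (φ : EV n → ℝ) := by
      intro h; apply hx; simp [hu, h]
    rw [φ.support_eq] at this
    exact ball_subset_closedBall this
  have hsob := eLpNorm_le_eLpNorm_fderiv_of_le (volume : Measure (EV n)) huC hus (p := P) (q := Q)
    (by rw [← NNReal.coe_le_coe, hP]; exact_mod_cast hp.le)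
    (by rw [hfin, ← NNReal.coe_lt_coe, hP]; exact_mod_cast hpn)
    (by
      rw [hfin, hQ, NNReal.coe_inv, hP, inv_sub_inv hp0.ne' hn0.ne', div_le_iff₀ (by positivity), inv_mul_eq_div,
        le_div_iff₀ hq0]
      rw [le_div_iff₀ (by linarith)] at hq
      linarith)
    isBounded_closedBall
  rw [eLpNorm_nnreal_eq_lintegral hP0, eLpNorm_nnreal_eq_lintegral hQ0, hP, hQ, ← hS] at hsob
  have hsob2 := ENNReal.rpow_le_rpow hsob hq0.le
  rw [ENNReal.mul_rpow_of_nonneg _ _ hq0.le, ← ENNReal.rpow_mul, ← ENNReal.rpow_mul,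
    one_div_mul_cancel hq0.ne', ENNReal.rpow_one, show 1 / p * q = q / p by ring] at hsob2
  have h1 : ∫⁻ x in ball (0 : EV n) 1, ‖f x‖ₑ ^ q ≤ ∫⁻ x, ‖u x‖ₑ ^ q := by
    refine le_trans ?_ (setLIntegral_le_lintegral (ball (0 : EV n) 1) _)
    refine setLIntegral_mono' measurableSet_ball fun x hx => ?_
    have : φ x = 1 := φ.one_of_mem_closedBall (ball_subset_closedBall hx)
    simp [hu, this]
  have hdu : ∀ x, ‖fderiv ℝ u x‖ₑ ^ p ≤ B.indicator (fun x => 2 ^ (p - 1) * (‖fderiv ℝ f x‖ₑ ^ p + m ^ p * ‖f x‖ₑ ^ p)) x := by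
    intro x
    by_cases hx : x ∈ B
    · rw [indicator_of_mem hx, ← ENNReal.mul_rpow_of_nonneg _ _ hp0.le]
      refine le_trans ?_ (ENNReal.rpow_add_le_mul_rpow_add_rpow _ _ hp.le)
      refine ENNReal.rpow_le_rpow ?_ hp0.le
      have e : fderiv ℝ u x = φ x • fderiv ℝ f x + f x • fderiv ℝ φ x :=
        fderiv_fun_mul (hφ.differentiable one_ne_zero x) (hf.differentiable one_ne_zero x)
      rw [e]
      have hadd : ∀ a b : EV n →L[ℝ] ℝ, ‖a + b‖ₑ ≤ ‖a‖ₑ + ‖b‖ₑ := by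
        intro a b
        rw [← ofReal_norm, ← ofReal_norm, ← ofReal_norm, ← ENNReal.ofReal_add (norm_nonneg a) (norm_nonneg b)]
        exact ENNReal.ofReal_le_ofReal (norm_add_le a b)
      refine (hadd _ _).trans (add_le_add ?_ ?_)
      · rw [enorm_smul]
        refine mul_le_of_le_one_left zero_le ?_
        rw [← ofReal_norm, Real.norm_of_nonneg φ.nonneg]
        simpa using ENNReal.ofReal_le_ofReal (φ.le_one (x := x))
      · rw [enorm_smul, mul_comm]
        refine mul_le_mul_left ?_ _
        rw [← ofReal_norm, hm]
        exact ENNReal.ofReal_le_ofReal (hM x)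
    · rw [indicator_of_notMem hx]
      have h0 : fderiv ℝ u x = 0 := by
        have : x ∉ tsupport u := by
          intro h
          have h2 := closure_minimal hus isClosed_closedBall h
          apply hx
          exact closedBall_subset_ball (by norm_num) h2
        exact image_eq_zero_of_notMem_tsupport (fun h => this (tsupport_fderiv_subset ℝ h))
      rw [h0, ← ofReal_norm, norm_zero]; simp [hp0]
  have h2 : ∫⁻ x, ‖fderiv ℝ u x‖ₑ ^ p ≤ K3 * ((∫⁻ x in B, ‖fderiv ℝ f x‖ₑ ^ p) + (∫⁻ x in B, ‖f x‖ₑ) ^ p) := by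
    refine (lintegral_mono hdu).trans ?_
    have hm7 : Measurable (fun x => ‖fderiv ℝ f x‖ₑ ^ p + m ^ p * ‖f x‖ₑ ^ p) :=
      (hgm.pow_const p).add ((hfm.pow_const p).const_mul _)
    rw [lintegral_indicator (show MeasurableSet B from measurableSet_ball),
      lintegral_const_mul _ hm7,
      lintegral_add_left (hgm.pow_const p), lintegral_const_mul _ (hfm.pow_const p), hK3, mul_assoc]
    refine mul_le_mul_right ?_ _
    rw [add_mul, one_mul, mul_assoc]
    exact add_le_add (le_add_right le_rfl) (mul_le_mul_right (hKP f hf) _)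
  refine h1.trans (hsob2.trans ?_)
  rw [mul_assoc]
  refine mul_le_mul_right ?_ _
  refine (ENNReal.rpow_le_rpow h2 hqp0).trans ?_
  rw [ENNReal.mul_rpow_of_nonneg _ _ hqp0, mul_assoc]
  refine mul_le_mul_right ((ENNReal.rpow_add_le_mul_rpow_add_rpow _ _ hqp).trans ?_) _
  rw [← ENNReal.rpow_mul, mul_div_cancel₀ _ hp0.ne']

lemma cmp_rpow {a b : ℝ} (ha : 0 < a) (hb : 0 < b) (h1 : a ≤ 2 * b) (h2 : b ≤ 2 * a) (β : ℝ) :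
    ENNReal.ofReal a ^ β ≤ ENNReal.ofReal (2 ^ |β|) * ENNReal.ofReal b ^ β := by
  rw [ENNReal.ofReal_rpow_of_pos ha, ENNReal.ofReal_rpow_of_pos hb, ← ENNReal.ofReal_mul (by positivity)]
  refine ENNReal.ofReal_le_ofReal ?_
  rcases le_total 0 β with h | h
  · rw [abs_of_nonneg h, ← Real.mul_rpow (by norm_num) hb.le]
    exact Real.rpow_le_rpow ha.le h1 h
  · rw [abs_of_nonpos h, Real.rpow_neg (by norm_num), ← Real.inv_rpow (by norm_num),
      ← Real.mul_rpow (by norm_num) hb.le]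
    exact Real.rpow_le_rpow_of_nonpos (by positivity) (by linarith) h

lemma infDist_cmp {n : ℕ} (E : Set (EV n)) {x z : EV n} (h : dist x z < infDist z E / 2) :
    0 < infDist x E ∧ 0 < infDist z E ∧ infDist x E ≤ 2 * infDist z E ∧
      infDist z E ≤ 2 * infDist x E ∧ dist x z < infDist x E := by
  have h1 := infDist_le_infDist_add_dist (s := E) (x := x) (y := z)
  have h2 := infDist_le_infDist_add_dist (s := E) (x := z) (y := x)
  rw [dist_comm z x] at h2
  have h3 : 0 ≤ dist x z := dist_nonneg
  refine ⟨by linarith, by linarith, by linarith, by linarith, by linarith⟩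

lemma ball_int_eq {n : ℕ} (E : Set (EV n)) (c : ℝ) (F : EV n → ℝ≥0∞) (z : EV n) :
    ∫⁻ x in ball z (infDist z E * c), F x =
      ∫⁻ x, {q : EV n × EV n | dist q.2 q.1 < infDist q.1 E * c}.indicator (fun _ => (1 : ℝ≥0∞)) (z, x) * F x := by
  rw [← lintegral_indicator measurableSet_ball]
  congr 1; ext x
  by_cases hx : dist x z < infDist z E * c
  · rw [indicator_of_mem (by simpa using hx), indicator_of_mem (by simpa using hx), one_mul]
  · rw [indicator_of_notMem (by simpa using hx), indicator_of_notMem (by simpa using hx), zero_mul]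

lemma S_meas {n : ℕ} (E : Set (EV n)) (c : ℝ) :
    Measurable ({q : EV n × EV n | dist q.2 q.1 < infDist q.1 E * c}.indicator (fun _ => (1 : ℝ≥0∞))) := by
  refine measurable_const.indicator ?_
  refine measurableSet_lt (by fun_prop) ?_
  exact ((continuous_infDist_pt E).comp continuous_fst).measurable.mul_const _

lemma ball_int_meas {n : ℕ} (E : Set (EV n)) (c : ℝ) {F : EV n → ℝ≥0∞} (hF : Measurable F) :
    Measurable (fun z => ∫⁻ x in ball z (infDist z E * c), F x) := by
  simp only [ball_int_eq]
  have h : Measurable (fun q : EV n × EV n =>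
    {q : EV n × EV n | dist q.2 q.1 < infDist q.1 E * c}.indicator (fun _ => (1 : ℝ≥0∞)) q * F q.2) :=
    (S_meas E c).mul (hF.comp measurable_snd)
  exact h.lintegral_prod_right'

lemma tonelli {n : ℕ} (E : Set (EV n)) (c a : ℝ) {F : EV n → ℝ≥0∞} (hF : Measurable F) :
    ∫⁻ z, ENNReal.ofReal (infDist z E) ^ a * ∫⁻ x in ball z (infDist z E * c), F x =
      ∫⁻ x, (∫⁻ z in {z | dist x z < infDist z E * c}, ENNReal.ofReal (infDist z E) ^ a) * F x := by
  have hd : Measurable (fun z : EV n => ENNReal.ofReal (infDist z E) ^ a) :=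
    (continuous_infDist_pt E).measurable.ennreal_ofReal.pow_const a
  simp only [ball_int_eq]
  have hS := S_meas E c
  set S := {q : EV n × EV n | dist q.2 q.1 < infDist q.1 E * c}.indicator (fun _ => (1 : ℝ≥0∞)) with hSd
  have h1 : ∀ z, Measurable (fun x => S (z, x)) := fun z => hS.comp measurable_prodMk_left
  have h1' : ∀ x, Measurable (fun z => S (z, x)) := fun z => hS.comp measurable_prodMk_right
  have h2 : Measurable (fun q : EV n × EV n => ENNReal.ofReal (infDist q.1 E) ^ a * (S q * F q.2)) :=
    (hd.comp measurable_fst).mul (hS.mul (hF.comp measurable_snd))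
  calc _ = ∫⁻ z, ∫⁻ x, ENNReal.ofReal (infDist z E) ^ a * (S (z, x) * F x) := by
        congr 1; ext z
        have h3 : Measurable (fun x => S (z, x) * F x) := (h1 z).mul hF
        rw [lintegral_const_mul _ h3]
    _ = ∫⁻ x, ∫⁻ z, ENNReal.ofReal (infDist z E) ^ a * (S (z, x) * F x) :=
        lintegral_lintegral_swap h2.aemeasurable
    _ = _ := by
        congr 1; ext x
        have hms : MeasurableSet {z : EV n | dist x z < infDist z E * c} :=
          measurableSet_lt (by fun_prop) ((continuous_infDist_pt E).measurable.mul_const _)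
        rw [← lintegral_indicator hms, ← lintegral_mul_const _ (hd.indicator hms)]
        congr 1; ext z
        by_cases hx : dist x z < infDist z E * c
        · rw [indicator_of_mem (by simpa using hx), hSd, indicator_of_mem (by simpa using hx), one_mul]
        · rw [indicator_of_notMem (by simpa using hx), hSd, indicator_of_notMem (by simpa using hx)]
          simp

lemma whit_lower {n : ℕ} (E : Set (EV n)) (hE0 : ∀ᵐ y : EV n, 0 < infDist y E) (γ : ℝ) :
    ∃ K : ℝ≥0∞, K ≠ ∞ ∧ ∀ F : EV n → ℝ≥0∞, Measurable F →
      ∫⁻ x, F x * ENNReal.ofReal (infDist x E) ^ γ ≤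
        K * ∫⁻ z, ENNReal.ofReal (infDist z E) ^ (γ - n) * ∫⁻ x in ball z (infDist z E * (1 / 4)), F x := by
  set c := ENNReal.ofReal ((1 / 8) ^ n) * volume (ball (0 : EV n) 1) with hc
  have hc0 : c ≠ 0 := mul_ne_zero (by simp) (measure_ball_pos volume _ one_pos).ne'
  have hct : c ≠ ∞ := ENNReal.mul_ne_top ENNReal.ofReal_ne_top measure_ball_lt_top.ne
  refine ⟨c⁻¹ * ENNReal.ofReal (2 ^ |γ - n|), ENNReal.mul_ne_top (ENNReal.inv_ne_top.2 hc0) ENNReal.ofReal_ne_top, fun F hF => ?_⟩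
  rw [tonelli E _ _ hF, mul_assoc, ← ENNReal.mul_le_iff_le_inv hc0 hct,
    ← lintegral_const_mul' _ _ hct, ← lintegral_const_mul' _ _ ENNReal.ofReal_ne_top]
  refine lintegral_mono_ae ?_
  filter_upwards [hE0] with x hx
  rw [mul_comm (F x), ← mul_assoc, ← mul_assoc]
  refine mul_le_mul_left ?_ _
  have hsub : ball x (infDist x E / 8) ⊆ {z | dist x z < infDist z E * (1 / 4)} := by
    intro z hz
    have h2 := infDist_le_infDist_add_dist (s := E) (x := x) (y := z)
    rw [mem_ball, dist_comm] at hz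
    simp only [mem_ofPred_eq]; linarith
  have hpt : ∀ z ∈ ball x (infDist x E / 8), ENNReal.ofReal (infDist x E) ^ (γ - n) ≤
      ENNReal.ofReal (2 ^ |γ - n|) * ENNReal.ofReal (infDist z E) ^ (γ - n) := by
    intro z hz
    have : dist z x < infDist x E / 2 := by rw [mem_ball] at hz; linarith
    obtain ⟨h1, h2, h3, h4, -⟩ := infDist_cmp E this
    exact cmp_rpow h2 h1 h4 h3 _
  calc c * ENNReal.ofReal (infDist x E) ^ γ
      = ∫⁻ z in ball x (infDist x E / 8), ENNReal.ofReal (infDist x E) ^ (γ - n) := by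
        rw [setLIntegral_const, vol_ball x (by linarith), hc, div_pow, div_pow, one_pow,
          ENNReal.rpow_sub _ _ (by simpa using hx) ENNReal.ofReal_ne_top, ENNReal.rpow_natCast,
          ← ENNReal.ofReal_pow hx.le, div_eq_mul_one_div (infDist x E ^ n), ENNReal.ofReal_mul (by positivity)]
        have h0 : ENNReal.ofReal (infDist x E ^ n) ≠ 0 := by simpa using pow_pos hx n
        set D := ENNReal.ofReal (infDist x E ^ n)
        rw [ENNReal.div_eq_inv_mul]
        have : D⁻¹ * D = 1 := ENNReal.inv_mul_cancel h0 ENNReal.ofReal_ne_top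
        calc _ = (D⁻¹ * D) * (ENNReal.ofReal (1 / 8 ^ n) * volume (ball (0 : EV n) 1) * ENNReal.ofReal (infDist x E) ^ γ) := by
              rw [this, one_mul]
          _ = _ := by ring
    _ ≤ ∫⁻ z in ball x (infDist x E / 8), ENNReal.ofReal (2 ^ |γ - n|) * ENNReal.ofReal (infDist z E) ^ (γ - n) :=
        setLIntegral_mono' measurableSet_ball hpt
    _ = ENNReal.ofReal (2 ^ |γ - n|) * ∫⁻ z in ball x (infDist x E / 8), ENNReal.ofReal (infDist z E) ^ (γ - n) :=
        lintegral_const_mul' _ _ ENNReal.ofReal_ne_top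
    _ ≤ _ := mul_le_mul_right (lintegral_mono_set hsub) _

lemma whit_upper {n : ℕ} (E : Set (EV n)) :
    ∃ K : ℝ≥0∞, K ≠ ∞ ∧ ∀ F : EV n → ℝ≥0∞, Measurable F →
      ∫⁻ z, ENNReal.ofReal (infDist z E) ^ (-(n : ℝ)) * ∫⁻ x in ball z (infDist z E * (1 / 2)), F x ≤
        K * ∫⁻ x, F x := by
  refine ⟨ENNReal.ofReal (2 ^ |-(n : ℝ)|) * volume (ball (0 : EV n) 1),
    ENNReal.mul_ne_top ENNReal.ofReal_ne_top measure_ball_lt_top.ne, fun F hF => ?_⟩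
  rw [tonelli E _ _ hF, ← lintegral_const_mul _ hF]
  refine lintegral_mono fun x => mul_le_mul_left ?_ _
  have hms : MeasurableSet {z : EV n | dist x z < infDist z E * (1 / 2)} :=
    measurableSet_lt (by fun_prop) ((continuous_infDist_pt E).measurable.mul_const _)
  have hk : ∀ z ∈ {z : EV n | dist x z < infDist z E * (1 / 2)}, dist x z < infDist z E / 2 := by
    intro z hz; simp only [mem_ofPred_eq] at hz; linarith
  rcases (infDist_nonneg (x := x) (s := E)).eq_or_lt with h0 | h0
  · have : {z : EV n | dist x z < infDist z E * (1 / 2)} = ∅ := by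
      rw [eq_empty_iff_forall_notMem]
      intro z hz
      have := (infDist_cmp E (hk z hz)).1
      linarith
    rw [this]; simp
  calc ∫⁻ z in {z : EV n | dist x z < infDist z E * (1 / 2)}, ENNReal.ofReal (infDist z E) ^ (-(n : ℝ))
      ≤ ∫⁻ z in {z : EV n | dist x z < infDist z E * (1 / 2)},
          ENNReal.ofReal (2 ^ |-(n : ℝ)|) * ENNReal.ofReal (infDist x E) ^ (-(n : ℝ)) := by
        refine setLIntegral_mono' hms fun z hz => ?_
        obtain ⟨h1, h2, h3, h4, -⟩ := infDist_cmp E (hk z hz)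
        exact cmp_rpow h2 h1 h4 h3 _
    _ ≤ ∫⁻ z in ball x (infDist x E),
          ENNReal.ofReal (2 ^ |-(n : ℝ)|) * ENNReal.ofReal (infDist x E) ^ (-(n : ℝ)) := by
        refine lintegral_mono_set fun z hz => ?_
        rw [mem_ball, dist_comm]
        exact (infDist_cmp E (hk z hz)).2.2.2.2
    _ = _ := by
        rw [setLIntegral_const, vol_ball x h0, ENNReal.rpow_neg, ENNReal.rpow_natCast, ← ENNReal.ofReal_pow h0.le]
        have h0 : ENNReal.ofReal (infDist x E ^ n) ≠ 0 := by simpa using pow_pos h0 n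
        set D := ENNReal.ofReal (infDist x E ^ n)
        have : D⁻¹ * D = 1 := ENNReal.inv_mul_cancel h0 ENNReal.ofReal_ne_top
        calc _ = ENNReal.ofReal (2 ^ |-(n : ℝ)|) * (D⁻¹ * D) * volume (ball (0 : EV n) 1) := by ring
          _ = _ := by rw [this, mul_one]

lemma localSob_scaled {n : ℕ} {p q : ℝ} (hp : 1 < p) {K : ℝ≥0∞}
    (hK : ∀ f : EV n → ℝ, ContDiff ℝ 1 f →
      ∫⁻ x in ball (0 : EV n) 1, ‖f x‖ₑ ^ q ≤
        K * ((∫⁻ x in ball (0 : EV n) 2, ‖fderiv ℝ f x‖ₑ ^ p) ^ (q / p) +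
          (∫⁻ x in ball (0 : EV n) 2, ‖f x‖ₑ) ^ q))
    {f : EV n → ℝ} (hf : ContDiff ℝ 1 f) (z : EV n) {r : ℝ} (hr : 0 < r) :
    ENNReal.ofReal ((r ^ n)⁻¹) * ∫⁻ x in ball z r, ‖f x‖ₑ ^ q ≤
      K * ((ENNReal.ofReal r ^ p * (ENNReal.ofReal ((r ^ n)⁻¹) *
        ∫⁻ x in ball z (r * 2), ‖fderiv ℝ f x‖ₑ ^ p)) ^ (q / p) +
        (∫⁻ w in ball (0 : EV n) 2, ‖f (z + r • w)‖ₑ) ^ q) := by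
  have h := hK (fun w => f (z + r • w)) (hf.comp (by fun_prop))
  rw [scale_setLIntegral (fun x => ‖f x‖ₑ ^ q) z hr, mul_one] at h
  have hd : ∀ w, ‖fderiv ℝ (fun w => f (z + r • w)) w‖ₑ ^ p =
      ENNReal.ofReal r ^ p * ‖fderiv ℝ f (z + r • w)‖ₑ ^ p := by
    intro w
    have h1 : HasFDerivAt (fun w : EV n => z + r • w) (r • ContinuousLinearMap.id ℝ (EV n)) w :=
      ((hasFDerivAt_id w).const_smul r).const_add z
    have h2 := ((hf.differentiable one_ne_zero (z + r • w)).hasFDerivAt).comp w h1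
    have h3 : fderiv ℝ (fun w => f (z + r • w)) w = r • fderiv ℝ f (z + r • w) := by
      refine h2.fderiv.trans ?_
      ext v; simp
    rw [h3, enorm_smul, ENNReal.mul_rpow_of_nonneg _ _ (by linarith), Real.enorm_of_nonneg hr.le]
  simp only [hd] at h
  rw [lintegral_const_mul' _ _ (ENNReal.rpow_ne_top_of_nonneg (by linarith) ENNReal.ofReal_ne_top),
    scale_setLIntegral (fun x => ‖fderiv ℝ f x‖ₑ ^ p) z hr] at h
  exact h

lemma avg_T {n : ℕ} (hn : 2 ≤ n) (E : Set (EV n)) {f : EV n → ℝ} (hf : ContDiff ℝ 1 f)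
    (hfc : HasCompactSupport f) (z : EV n) (hz : 0 < infDist z E) :
    ∫⁻ w in ball (0 : EV n) 2, ‖f (z + (infDist z E * (1 / 4)) • w)‖ₑ ≤
      ENNReal.ofReal (2 ^ n * 6 ^ (n - 1 : ℝ)) *
        ∫⁻ y, ENNReal.ofReal (infDist z E + dist z y + infDist y E) ^ (-(n - 1 : ℝ)) * ‖fderiv ℝ f y‖ₑ := by
  have hn1 : (0 : ℝ) ≤ n - 1 := by
    have : (2 : ℝ) ≤ n := by exact_mod_cast hn
    linarith
  set d := infDist z E with hd
  have h := avg_bound hn hf hfc z (r := d * (1 / 2)) (by linarith)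
  have e : ∫⁻ w in ball (0 : EV n) 2, ‖f (z + (d * (1 / 4)) • w)‖ₑ =
      ENNReal.ofReal (2 ^ n) * ∫⁻ w in ball (0 : EV n) 1, ‖f (z + (d * (1 / 2)) • w)‖ₑ := by
    rw [scale_setLIntegral (fun x => ‖f x‖ₑ) z (by linarith), scale_setLIntegral (fun x => ‖f x‖ₑ) z (by linarith),
      ← mul_assoc, ← ENNReal.ofReal_mul (by positivity)]
    congr 2
    · rw [show d * (1 / 2) = 2 * (d * (1 / 4)) by ring, mul_pow 2]
      field_simp
    · congr 2; ring
  rw [e, ENNReal.ofReal_mul (by positivity), mul_assoc]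
  refine mul_le_mul_right (h.trans ?_) _
  rw [← lintegral_const_mul' _ _ ENNReal.ofReal_ne_top]
  refine lintegral_mono fun y => ?_
  rw [← mul_assoc]
  refine mul_le_mul_left ?_ _
  have h2 := infDist_le_infDist_add_dist (s := E) (x := y) (y := z)
  rw [dist_comm y z, ← hd] at h2
  have hm1 := le_max_left (d * (1 / 2)) (dist z y)
  have hm2 := le_max_right (d * (1 / 2)) (dist z y)
  have h5 : 0 ≤ infDist y E := infDist_nonneg
  have h6 : 0 ≤ dist z y := dist_nonneg
  have hpos : 0 < d + dist z y + infDist y E := by linarith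
  have hmp : 0 < max (d * (1 / 2)) (dist z y) := by linarith
  rw [ENNReal.ofReal_rpow_of_pos hmp, ENNReal.ofReal_rpow_of_pos hpos, ← ENNReal.ofReal_mul (by positivity)]
  refine ENNReal.ofReal_le_ofReal ?_
  have h7 : (6 : ℝ) ^ (n - 1 : ℝ) = (6⁻¹ : ℝ) ^ (-(n - 1 : ℝ)) := by
    rw [Real.inv_rpow (by norm_num), Real.rpow_neg (by norm_num), inv_inv]
  rw [h7, ← Real.mul_rpow (by norm_num) hpos.le]
  exact Real.rpow_le_rpow_of_nonpos (by positivity) (by linarith) (by linarith)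

lemma whit_point {n : ℕ} (hn : 2 ≤ n) (E : Set (EV n)) {p q : ℝ} (β γ : ℝ) (hp : 1 < p) (hpq : p ≤ q) (hpn : p < n)
    (hq : q ≤ n * p / (n - p)) (hγ : γ = q / p * (n - p + β) - n) :
    ∃ K : ℝ≥0∞, K ≠ ∞ ∧ ∀ f : EV n → ℝ, ContDiff ℝ 1 f → HasCompactSupport f →
      ∀ z, 0 < infDist z E →
      ENNReal.ofReal (infDist z E) ^ (γ - n) * ∫⁻ x in ball z (infDist z E * (1 / 4)), ‖f x‖ₑ ^ q ≤
        K * (ENNReal.ofReal (infDist z E) ^ (-(n : ℝ)) *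
          (∫⁻ x in ball z (infDist z E * (1 / 2)), ‖fderiv ℝ f x‖ₑ ^ p * ENNReal.ofReal (infDist x E) ^ β) ^ (q / p) +
          ENNReal.ofReal (infDist z E) ^ γ *
          (∫⁻ y, ENNReal.ofReal (infDist z E + dist z y + infDist y E) ^ (-(n - 1 : ℝ)) * ‖fderiv ℝ f y‖ₑ) ^ q) := by
  have hp0 : 0 < p := by linarith
  have hq0 : 0 < q := by linarith
  have hqp0 : 0 ≤ q / p := by positivity
  obtain ⟨K, hKt, hK⟩ := localSob hn hp hpq hpn hq
  set c1 : ℝ≥0∞ := (ENNReal.ofReal (4 ^ n) * ENNReal.ofReal (2 ^ |β|)) ^ (q / p) with hc1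
  set c2 : ℝ≥0∞ := (ENNReal.ofReal (2 ^ n * 6 ^ (n - 1 : ℝ))) ^ q with hc2
  have hc1t : c1 ≠ ∞ := ENNReal.rpow_ne_top_of_nonneg hqp0 (ENNReal.mul_ne_top ENNReal.ofReal_ne_top ENNReal.ofReal_ne_top)
  have hc2t : c2 ≠ ∞ := ENNReal.rpow_ne_top_of_nonneg hq0.le ENNReal.ofReal_ne_top
  refine ⟨K * (c1 + c2), ENNReal.mul_ne_top hKt (ENNReal.add_ne_top.2 ⟨hc1t, hc2t⟩), fun f hf hfc z hz => ?_⟩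
  have hA := avg_T hn E hf hfc z hz
  have hloc := localSob_scaled hp hK hf z (r := infDist z E * (1 / 4)) (by linarith)
  rw [show infDist z E * (1 / 4) * 2 = infDist z E * (1 / 2) by ring] at hloc
  set d := infDist z E with hd
  set D := ENNReal.ofReal d with hD
  have hD0 : D ≠ 0 := by rw [hD]; simpa using hz
  have hDt : D ≠ ∞ := ENNReal.ofReal_ne_top
  set A := ∫⁻ w in ball (0 : EV n) 2, ‖f (z + (d * (1 / 4)) • w)‖ₑ with hAd
  set T := ∫⁻ y, ENNReal.ofReal (d + dist z y + infDist y E) ^ (-(n - 1 : ℝ)) * ‖fderiv ℝ f y‖ₑ with hT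
  set I := ∫⁻ x in ball z (d * (1 / 2)), ‖fderiv ℝ f x‖ₑ ^ p with hI
  set J := ∫⁻ x in ball z (d * (1 / 2)), ‖fderiv ℝ f x‖ₑ ^ p * ENNReal.ofReal (infDist x E) ^ β with hJ
  set L := ∫⁻ x in ball z (d * (1 / 4)), ‖f x‖ₑ ^ q with hL
  have er : ENNReal.ofReal (((d * (1 / 4)) ^ n)⁻¹) = ENNReal.ofReal (4 ^ n) * D ^ (-(n : ℝ)) := by
    rw [hD, ENNReal.ofReal_rpow_of_pos hz, ← ENNReal.ofReal_mul (by positivity), Real.rpow_neg hz.le, Real.rpow_natCast]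
    congr 1
    rw [mul_pow, one_div, inv_pow]; field_simp
  have hIJ : I ≤ ENNReal.ofReal (2 ^ |β|) * D ^ (-β) * J := by
    rw [hI, hJ, ← lintegral_const_mul' _ _ (ENNReal.mul_ne_top ENNReal.ofReal_ne_top (ENNReal.rpow_ne_top_of_ne_zero hD0 hDt))]
    refine setLIntegral_mono' measurableSet_ball fun x hx => ?_
    have hx' : dist x z < infDist z E / 2 := by rw [mem_ball] at hx; rw [← hd]; linarith
    obtain ⟨h1, h2, h3, h4, -⟩ := infDist_cmp E hx'
    have h5 := cmp_rpow h2 h1 h4 h3 β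
    rw [← hd, ← hD] at h5
    have h6 : D ^ (-β) * D ^ β = 1 := by rw [← ENNReal.rpow_add _ _ hD0 hDt]; simp
    calc ‖fderiv ℝ f x‖ₑ ^ p = D ^ (-β) * ‖fderiv ℝ f x‖ₑ ^ p * D ^ β := by
          rw [mul_right_comm, h6, one_mul]
      _ ≤ D ^ (-β) * ‖fderiv ℝ f x‖ₑ ^ p * (ENNReal.ofReal (2 ^ |β|) * ENNReal.ofReal (infDist x E) ^ β) :=
          mul_le_mul_right h5 _
      _ = _ := by ring
  have hX : ENNReal.ofReal (d * (1 / 4)) ^ p * (ENNReal.ofReal (((d * (1 / 4)) ^ n)⁻¹) * I) ≤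
      (ENNReal.ofReal (4 ^ n) * ENNReal.ofReal (2 ^ |β|)) * (D ^ (p - n - β) * J) := by
    calc _ ≤ D ^ p * (ENNReal.ofReal (4 ^ n) * D ^ (-(n : ℝ)) * (ENNReal.ofReal (2 ^ |β|) * D ^ (-β) * J)) := by
          rw [er]
          refine mul_le_mul' (ENNReal.rpow_le_rpow (ENNReal.ofReal_le_ofReal (by linarith)) hp0.le) ?_
          exact mul_le_mul_right hIJ _
      _ = _ := by
          rw [show p - n - β = p + -(n : ℝ) + -β by ring, ENNReal.rpow_add _ _ hD0 hDt, ENNReal.rpow_add _ _ hD0 hDt]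
          ring
  have hX2 : D ^ γ * (ENNReal.ofReal (d * (1 / 4)) ^ p * (ENNReal.ofReal (((d * (1 / 4)) ^ n)⁻¹) * I)) ^ (q / p) ≤
      c1 * (D ^ (-(n : ℝ)) * J ^ (q / p)) := by
    refine (mul_le_mul_right (ENNReal.rpow_le_rpow hX hqp0) _).trans (le_of_eq ?_)
    rw [ENNReal.mul_rpow_of_nonneg _ _ hqp0, ENNReal.mul_rpow_of_nonneg (D ^ (p - n - β)) _ hqp0, ← hc1, ← ENNReal.rpow_mul,
      show -(n : ℝ) = γ + (p - n - β) * (q / p) by rw [hγ]; ring, ENNReal.rpow_add _ _ hD0 hDt]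
    ring
  have hA2 : D ^ γ * A ^ q ≤ c2 * (D ^ γ * T ^ q) := by
    refine (mul_le_mul_right (ENNReal.rpow_le_rpow hA hq0.le) _).trans (le_of_eq ?_)
    rw [ENNReal.mul_rpow_of_nonneg _ _ hq0.le, ← hc2]; ring
  calc D ^ (γ - n) * L ≤ D ^ γ * (ENNReal.ofReal (((d * (1 / 4)) ^ n)⁻¹) * L) := by
        rw [er, sub_eq_add_neg, ENNReal.rpow_add _ _ hD0 hDt, mul_assoc]
        refine mul_le_mul_right ?_ _
        refine mul_le_mul_left ?_ _
        refine le_mul_of_one_le_left zero_le ?_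
        rw [ENNReal.one_le_ofReal]
        exact one_le_pow₀ (by norm_num)
    _ ≤ D ^ γ * (K * ((ENNReal.ofReal (d * (1 / 4)) ^ p * (ENNReal.ofReal (((d * (1 / 4)) ^ n)⁻¹) * I)) ^ (q / p) + A ^ q)) :=
        mul_le_mul_right hloc _
    _ = K * (D ^ γ * (ENNReal.ofReal (d * (1 / 4)) ^ p * (ENNReal.ofReal (((d * (1 / 4)) ^ n)⁻¹) * I)) ^ (q / p) + D ^ γ * A ^ q) := by ring
    _ ≤ K * (c1 * (D ^ (-(n : ℝ)) * J ^ (q / p)) + c2 * (D ^ γ * T ^ q)) := mul_le_mul_right (add_le_add hX2 hA2) _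
    _ ≤ K * ((c1 + c2) * (D ^ (-(n : ℝ)) * J ^ (q / p)) + (c1 + c2) * (D ^ γ * T ^ q)) := by
        refine mul_le_mul_right (add_le_add (mul_le_mul_left (le_add_right le_rfl) _) (mul_le_mul_left (le_add_left le_rfl) _)) _
    _ = _ := by ring

lemma hs_main {n : ℕ} (hn : 2 ≤ n) {E : Set (EV n)} (hE : E.Nonempty) (hEc : IsClosed E) {p q β : ℝ}
    (hp : 1 < p) (hpq : p ≤ q) (hpn : p < n) (hq : q ≤ n * p / (n - p))
    (hdim : assouadDim E < min (q / p * (n - p + β)) (n - β / (p - 1))) :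
    ∃ K : ℝ≥0∞, K ≠ ∞ ∧ ∀ f : EV n → ℝ, ContDiff ℝ 1 f → HasCompactSupport f →
      ∫⁻ x, ‖f x‖ₑ ^ q * ENNReal.ofReal (infDist x E) ^ (q / p * (n - p + β) - n) ≤
        K * (∫⁻ x, ‖fderiv ℝ f x‖ₑ ^ p * ENNReal.ofReal (infDist x E) ^ β) ^ (q / p) := by
  have hp0 : 0 < p := by linarith
  have hq0 : 0 < q := by linarith
  have hqp : 1 ≤ q / p := by rwa [le_div_iff₀ hp0, one_mul]
  obtain ⟨s, C, hs, hsm, hC, hcov⟩ := exists_covData hn E hdim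
  have h1 : s < q / p * (n - p + β) := hsm.trans_le (min_le_left _ _)
  have h2 : s < n - β / (p - 1) := hsm.trans_le (min_le_right _ _)
  have hsn : s < n := by
    rcases le_total 0 β with h | h
    · have : 0 ≤ β / (p - 1) := div_nonneg h (by linarith)
      linarith
    · have e1 : q / p * (n - p + β) ≤ q / p * (n - p) := by
        refine mul_le_mul_of_nonneg_left (by linarith) (by positivity)
      have e2 : q / p * (n - p) ≤ n := by
        rw [div_mul_eq_mul_div, div_le_iff₀ hp0]
        rwa [le_div_iff₀ (by linarith)] at hq
      linarith
  have hE0 := ae_pos hE hEc (vol_E hC hcov hsn)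
  obtain ⟨γ, hγ⟩ : ∃ γ : ℝ, γ = q / p * (n - p + β) - n := ⟨_, rfl⟩
  obtain ⟨K0, hK0, hnl⟩ := nonlocal hE hEc hs hC hcov hsn hp hpq h1 h2
  obtain ⟨K1, hK1, hlow⟩ := whit_lower E hE0 γ
  obtain ⟨K2, hK2, hup⟩ := whit_upper E
  obtain ⟨K3, hK3, hpt⟩ := whit_point hn E β γ hp hpq hpn hq hγ
  rw [← hγ] at *
  refine ⟨K1 * (K3 * (K2 + ENNReal.ofReal K0)), ENNReal.mul_ne_top hK1 (ENNReal.mul_ne_top hK3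
    (ENNReal.add_ne_top.2 ⟨hK2, ENNReal.ofReal_ne_top⟩)), fun f hf hfc => ?_⟩
  have hgm : Measurable (fun y => ‖fderiv ℝ f y‖ₑ) := (hf.continuous_fderiv one_ne_zero).enorm.measurable
  have hfm : Measurable (fun y => ‖f y‖ₑ) := hf.continuous.enorm.measurable
  have hdm : ∀ a : ℝ, Measurable (fun z : EV n => ENNReal.ofReal (infDist z E) ^ a) := fun a =>
    (continuous_infDist_pt E).measurable.ennreal_ofReal.pow_const a
  obtain ⟨G, hG⟩ : ∃ G : EV n → ℝ≥0∞, G = fun x => ‖fderiv ℝ f x‖ₑ ^ p * ENNReal.ofReal (infDist x E) ^ β := ⟨_, rfl⟩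
  have hGm : Measurable G := by rw [hG]; exact (hgm.pow_const p).mul (hdm β)
  have hGx : ∀ x, ‖fderiv ℝ f x‖ₑ ^ p * ENNReal.ofReal (infDist x E) ^ β = G x := by intro x; rw [hG]
  have hJm := ball_int_meas E (1 / 2) hGm
  have hnl' := hnl _ hgm
  have hpt' := hpt f hf hfc
  simp only [hGx] at hnl' hpt' ⊢
  obtain ⟨J, hJ⟩ : ∃ J : EV n → ℝ≥0∞, J = fun z => ∫⁻ x in ball z (infDist z E * (1 / 2)), G x := ⟨_, rfl⟩
  obtain ⟨T, hT⟩ : ∃ T : EV n → ℝ≥0∞, T = fun z => ∫⁻ y, ENNReal.ofReal (infDist z E + dist z y + infDist y E) ^ (-(n - 1 : ℝ)) * ‖fderiv ℝ f y‖ₑ := ⟨_, rfl⟩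
  have hJx : ∀ z, ∫⁻ x in ball z (infDist z E * (1 / 2)), G x = J z := by intro z; rw [hJ]
  have hTx : ∀ z, ∫⁻ y, ENNReal.ofReal (infDist z E + dist z y + infDist y E) ^ (-(n - 1 : ℝ)) * ‖fderiv ℝ f y‖ₑ = T z := by
    intro z; rw [hT]
  have hup' := hup G hGm
  simp only [hJx, hTx] at hnl' hpt' hJm hup'
  set N := ∫⁻ x, G x with hN
  have hJN : ∀ z, J z ^ (q / p) ≤ N ^ (q / p - 1) * J z := by
    intro z
    have e : J z ^ (q / p) = J z ^ (q / p - 1) * J z := by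
      nth_rw 3 [← ENNReal.rpow_one (J z)]
      rw [← ENNReal.rpow_add_of_nonneg _ _ (by linarith) zero_le_one]; congr 1; ring
    rw [e]
    refine mul_le_mul_left (ENNReal.rpow_le_rpow ?_ (by linarith)) _
    rw [← hJx]; exact setLIntegral_le_lintegral _ _
  have hfirst : ∫⁻ z, ENNReal.ofReal (infDist z E) ^ (-(n : ℝ)) * J z ^ (q / p) ≤ K2 * N ^ (q / p) := by
    calc _ ≤ ∫⁻ z, N ^ (q / p - 1) * (ENNReal.ofReal (infDist z E) ^ (-(n : ℝ)) * J z) := by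
          refine lintegral_mono fun z => ?_
          rw [mul_left_comm]
          exact mul_le_mul_right (hJN z) _
      _ = N ^ (q / p - 1) * ∫⁻ z, ENNReal.ofReal (infDist z E) ^ (-(n : ℝ)) * J z := by
          have h3 : Measurable (fun z => ENNReal.ofReal (infDist z E) ^ (-(n : ℝ)) * J z) := (hdm _).mul hJm
          rw [lintegral_const_mul _ h3]
      _ ≤ N ^ (q / p - 1) * (K2 * N) := mul_le_mul_right hup' _
      _ = K2 * (N ^ (q / p - 1) * N ^ (1 : ℝ)) := by rw [ENNReal.rpow_one]; ring
      _ = _ := by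
          rw [← ENNReal.rpow_add_of_nonneg _ _ (by linarith) zero_le_one]; congr 2; ring
  have hfq : Measurable (fun x => ‖f x‖ₑ ^ q) := hfm.pow_const q
  refine (hlow _ hfq).trans ?_
  rw [mul_assoc]
  refine mul_le_mul_right ?_ _
  calc _ ≤ ∫⁻ z, K3 * (ENNReal.ofReal (infDist z E) ^ (-(n : ℝ)) * J z ^ (q / p) +
            ENNReal.ofReal (infDist z E) ^ γ * T z ^ q) := by
        refine lintegral_mono_ae ?_
        filter_upwards [hE0] with z hz
        exact hpt' z hz
    _ = K3 * ((∫⁻ z, ENNReal.ofReal (infDist z E) ^ (-(n : ℝ)) * J z ^ (q / p)) +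
            ∫⁻ z, ENNReal.ofReal (infDist z E) ^ γ * T z ^ q) := by
        have h3 : Measurable (fun z => ENNReal.ofReal (infDist z E) ^ (-(n : ℝ)) * J z ^ (q / p)) :=
          (hdm _).mul (hJm.pow_const _)
        rw [lintegral_const_mul' _ _ hK3, lintegral_add_left h3]
    _ ≤ K3 * (K2 * N ^ (q / p) + ENNReal.ofReal K0 * N ^ (q / p)) :=
        mul_le_mul_right (add_le_add hfirst hnl') _
    _ = _ := by ring


theorem hardy_sobolev_euclidean (n : ℕ) (hn : 2 ≤ n)
    (E : Set (EuclideanSpace ℝ (Fin n))) (hE : E.Nonempty) (hEc : IsClosed E)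
    (p q β : ℝ) (hp : 1 < p) (hpq : p ≤ q) (hpn : p < n)
    (hq : q ≤ n * p / (n - p))
    (hdim : assouadDim E < min (q / p * (n - p + β)) (n - β / (p - 1))) :
    ∃ C : ℝ, 0 < C ∧ ∀ f : EuclideanSpace ℝ (Fin n) → ℝ,
      ContDiff ℝ (⊤ : ℕ∞) f → HasCompactSupport f →
      (∫⁻ x, ENNReal.ofReal |f x| ^ q *
          ENNReal.ofReal (infDist x E) ^ (q / p * (n - p + β) - n) ∂volume) ^ (1 / q) ≤
        ENNReal.ofReal C *
          (∫⁻ x, ENNReal.ofReal ‖gradient f x‖ ^ p *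
            ENNReal.ofReal (infDist x E) ^ β ∂volume) ^ (1 / p) := by

  have hp0 : 0 < p := by linarith
  have hq0 : 0 < q := by linarith
  obtain ⟨K, hKt, hK⟩ := hs_main hn hE hEc hp hpq hpn hq hdim
  have hKq : K ^ (1 / q) ≠ ∞ := ENNReal.rpow_ne_top_of_nonneg (by positivity) hKt
  refine ⟨(K ^ (1 / q)).toReal + 1, by positivity, fun f hf hfc => ?_⟩
  have h := hK f (hf.of_le (by exact_mod_cast le_top)) hfc
  have e1 : ∀ x, ENNReal.ofReal |f x| = ‖f x‖ₑ := fun x => by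
    rw [← ofReal_norm, Real.norm_eq_abs]
  have e2 : ∀ x, ENNReal.ofReal ‖gradient f x‖ = ‖fderiv ℝ f x‖ₑ := fun x => by
    rw [← ofReal_norm, gradient, LinearIsometryEquiv.norm_map]
  simp only [e1, e2]
  refine (ENNReal.rpow_le_rpow h (by positivity : (0 : ℝ) ≤ 1 / q)).trans ?_
  rw [ENNReal.mul_rpow_of_nonneg _ _ (by positivity), ← ENNReal.rpow_mul,
    show q / p * (1 / q) = 1 / p by field_simp]
  refine mul_le_mul_left ?_ _
  rw [ENNReal.le_ofReal_iff_toReal_le hKq (by positivity)]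
  linarith

end
end ApDistance
end

section
/- Let E = ∂([0,1]^2) ⊂ ℝ^2 be the boundary of the unit square, and let 1 < p ≤ q ≤ 2p/(2−p) < ∞. If β > p−1, then there is no constant C > 0 such that the weighted Hardy–Sobolev inequality (∫_{ℝ^2} |f(x)|^q δ_E(x)^{(q/p)(2−p+β)−2} dx)^{1/q} ≤ C (∫_{ℝ^2} |∇f(x)|^p δ_E(x)^β dx)^{1/p} holds for every f ∈ C_0^∞(ℝ^2). Moreover, in the case q = p the inequality also fails for β = p−1. -/
open MeasureTheory Metric Set
open scoped ENNReal NNReal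

namespace ApDistance

noncomputable section

variable {X : Type*} [MetricSpace X] [MeasurableSpace X] [BorelSpace X]

/-- The closed unit square in the Euclidean plane. -/
def unitSquare : Set (EuclideanSpace ℝ (Fin 2)) :=
  {x : EuclideanSpace ℝ (Fin 2) | ∀ i : Fin 2, x i ∈ Set.Icc (0 : ℝ) 1}

lemma isClosed_unitSquare : IsClosed unitSquare := by
  have : unitSquare = ⋂ i : Fin 2, (fun x : EuclideanSpace ℝ (Fin 2) => x i) ⁻¹' Set.Icc (0:ℝ) 1 := by
    ext x; simp [unitSquare]
  rw [this]
  exact isClosed_iInter fun i => isClosed_Icc.preimage (by fun_prop)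

lemma mem_frontier_sq (x : EuclideanSpace ℝ (Fin 2)) (hx : x ∈ unitSquare) (i : Fin 2) (h : x i = 0 ∨ x i = 1) :
    x ∈ frontier unitSquare := by
  rw [isClosed_unitSquare.frontier_eq]
  refine ⟨hx, fun hi => ?_⟩
  rw [mem_interior_iff_mem_nhds, Metric.mem_nhds_iff] at hi
  obtain ⟨ε, hε, hb⟩ := hi
  have key : ∀ t : ℝ, |t| < ε → x i + t ∈ Set.Icc (0:ℝ) 1 := by
    intro t ht
    have h1 : x + t • EuclideanSpace.single i (1:ℝ) ∈ ball x ε := by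
      rw [mem_ball, dist_self_add_left, norm_smul]; simpa using ht
    have := hb h1 i
    simpa using this
  rcases h with h | h
  · have := (key (-(ε/2)) (by rw [abs_neg, abs_of_pos (by linarith)]; linarith)).1
    linarith
  · have := (key (ε/2) (by rw [abs_of_pos (by linarith)]; linarith)).2
    linarith

lemma infDist_le_aux (x : EuclideanSpace ℝ (Fin 2)) (hx : x ∈ unitSquare) (i : Fin 2) (t : ℝ) 
    (h : x i + t = 0 ∨ x i + t = 1) : infDist x (frontier unitSquare) ≤ |t| := by
  have h2 : x + t • EuclideanSpace.single i (1:ℝ) ∈ frontier unitSquare := by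
    apply mem_frontier_sq _ _ i
    · simpa using h
    · intro k
      by_cases hk : k = i
      · subst hk
        rcases h with h | h <;> simp [h]
      · simpa [hk] using hx k
  have := infDist_le_dist_of_mem (x := x) h2
  rw [dist_self_add_right, norm_smul] at this
  simpa using this

lemma infDist_le_left (x : EuclideanSpace ℝ (Fin 2)) (hx : x ∈ unitSquare) (i : Fin 2) :
    infDist x (frontier unitSquare) ≤ x i := by
  have := infDist_le_aux x hx i (-x i) (by simp)
  rwa [abs_neg, abs_of_nonneg (hx i).1] at this

lemma infDist_le_right (x : EuclideanSpace ℝ (Fin 2)) (hx : x ∈ unitSquare) (i : Fin 2) :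
    infDist x (frontier unitSquare) ≤ 1 - x i := by
  have := infDist_le_aux x hx i (1 - x i) (by simp)
  rwa [abs_of_nonneg (by linarith [(hx i).2])] at this

lemma infDist_pos_sq (x : EuclideanSpace ℝ (Fin 2)) (hx : ∀ i, x i ∈ Set.Ioo (0:ℝ) 1) :
    0 < infDist x (frontier unitSquare) := by
  have hne : (frontier unitSquare).Nonempty := 
    ⟨0, mem_frontier_sq 0 (by intro i; simp) 0 (by simp)⟩
  rw [← (isClosed_frontier).notMem_iff_infDist_pos hne]
  intro h
  rw [isClosed_unitSquare.frontier_eq] at h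
  apply h.2
  have ho : IsOpen (⋂ i : Fin 2, (fun x : EuclideanSpace ℝ (Fin 2) => x i) ⁻¹' Set.Ioo (0:ℝ) 1) :=
    isOpen_iInter_of_finite fun i => isOpen_Ioo.preimage (by fun_prop)
  refine interior_maximal ?_ ho (by simpa using hx)
  intro y hy i
  simp only [mem_iInter, mem_preimage] at hy
  exact Ioo_subset_Icc_self (hy i)

/-- change of variables to the product plane -/
lemma mp_pair : MeasurePreserving (fun x : EuclideanSpace ℝ (Fin 2) => (x 0, x 1)) volume volume := 
  (volume_preserving_finTwoArrow ℝ).comp (EuclideanSpace.volume_preserving_symm_measurableEquiv_toLp (Fin 2))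

lemma volume_box (A B : Set ℝ) (hA : MeasurableSet A) (hB : MeasurableSet B) :
    volume {x : EuclideanSpace ℝ (Fin 2) | x 0 ∈ A ∧ x 1 ∈ B} = volume A * volume B := by
  have := mp_pair.measure_preimage (hA.prod hB).nullMeasurableSet
  rw [Measure.volume_eq_prod, Measure.prod_prod] at this
  exact this

lemma smoothTransition_lip : ∃ K : ℝ, 0 < K ∧ ∀ s t : ℝ,
    |Real.smoothTransition s - Real.smoothTransition t| ≤ K * |s - t| := by
  have hc : ContDiff ℝ 1 Real.smoothTransition := Real.smoothTransition.contDiff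
  have hcd : Continuous (deriv Real.smoothTransition) := hc.continuous_deriv le_rfl
  obtain ⟨K, hK⟩ := (isCompact_Icc (a := (0:ℝ)) (b := 1)).exists_bound_of_continuousOn hcd.continuousOn
  have hb : ∀ t, ‖deriv Real.smoothTransition t‖ ≤ max K 1 := by
    intro t
    by_cases ht : t ∈ Set.Icc (0:ℝ) 1
    · exact (hK t ht).trans (le_max_left _ _)
    · have : deriv Real.smoothTransition t = 0 := by
        by_cases h0 : t < 0
        · apply IsLocalMin.deriv_eq_zero
          refine Filter.Eventually.of_forall fun s => ?_
          rw [Real.smoothTransition.zero_of_nonpos h0.le]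
          exact Real.smoothTransition.nonneg _
        · have h1 : 1 < t := by
            by_contra h; exact ht ⟨not_lt.1 h0, not_lt.1 h⟩
          apply IsLocalMax.deriv_eq_zero
          refine Filter.Eventually.of_forall fun s => ?_
          rw [Real.smoothTransition.one_of_one_le h1.le]
          exact Real.smoothTransition.le_one _
      rw [this]; simp
  refine ⟨max K 1, by positivity, fun s t => ?_⟩
  have := Convex.norm_image_sub_le_of_norm_deriv_le (f := Real.smoothTransition) (s := univ) (x := t) (y := s)
    (fun x _ => (hc.differentiable one_ne_zero) x) (fun x _ => hb x) convex_univ trivial trivial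
  simpa using this

/-- one-dimensional cut-off -/
def cut (n : ℝ) (t : ℝ) : ℝ := Real.smoothTransition (n * t) * Real.smoothTransition (n * (1 - t))

lemma cut_nonneg (n t : ℝ) : 0 ≤ cut n t := 
  mul_nonneg (Real.smoothTransition.nonneg _) (Real.smoothTransition.nonneg _)

lemma cut_le_one (n t : ℝ) : cut n t ≤ 1 := 
  mul_le_one₀ (Real.smoothTransition.le_one _) (Real.smoothTransition.nonneg _) (Real.smoothTransition.le_one _)

lemma mul_lip {a b c d : ℝ} (ha : 0 ≤ a) (ha1 : a ≤ 1) (hd : 0 ≤ d) (hd1 : d ≤ 1) :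
    |a * b - c * d| ≤ |a - c| + |b - d| := by
  have : a * b - c * d = a * (b - d) + (a - c) * d := by ring
  rw [this]
  refine (abs_add_le _ _).trans ?_
  rw [abs_mul, abs_mul, abs_of_nonneg ha, abs_of_nonneg hd]
  nlinarith [abs_nonneg (b-d), abs_nonneg (a-c)]

lemma cut_lip {K : ℝ} (hK : ∀ s t : ℝ,
    |Real.smoothTransition s - Real.smoothTransition t| ≤ K * |s - t|) {n : ℝ} (hn : 0 < n) (s t : ℝ) :
    |cut n s - cut n t| ≤ 2 * K * n * |s - t| := by
  have h1 := hK (n * s) (n * t)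
  have h2 := hK (n * (1 - s)) (n * (1 - t))
  have e1 : |n * s - n * t| = n * |s - t| := by rw [← mul_sub, abs_mul, abs_of_pos hn]
  have e2 : |n * (1 - s) - n * (1 - t)| = n * |s - t| := by
    rw [← mul_sub, abs_mul, abs_of_pos hn, abs_sub_comm s t]; ring_nf
  rw [e1] at h1
  rw [e2] at h2
  have := mul_lip (b := Real.smoothTransition (n * (1 - s))) (c := Real.smoothTransition (n * t)) 
    (Real.smoothTransition.nonneg (n * s)) (Real.smoothTransition.le_one (n * s))
    (Real.smoothTransition.nonneg (n * (1 - t))) (Real.smoothTransition.le_one (n * (1 - t)))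
  unfold cut
  linarith

lemma cut_eq_one {n t : ℝ} (hn : 0 < n) (ht : t ∈ Set.Icc (1/n) (1 - 1/n)) : cut n t = 1 := by
  have h1 : 1 ≤ n * t := by
    have := mul_le_mul_of_nonneg_left ht.1 hn.le
    rwa [mul_one_div_cancel hn.ne'] at this
  have h2 : 1 ≤ n * (1 - t) := by
    have := mul_le_mul_of_nonneg_left (show 1 / n ≤ 1 - t by linarith [ht.2]) hn.le
    rwa [mul_one_div_cancel hn.ne'] at this
  simp [cut, Real.smoothTransition.one_of_one_le h1, Real.smoothTransition.one_of_one_le h2]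

lemma cut_eq_zero {n t : ℝ} (hn : 0 < n) (ht : t ∉ Set.Icc (0:ℝ) 1) : cut n t = 0 := by
  by_cases h : t < 0
  · rw [cut, Real.smoothTransition.zero_of_nonpos (by nlinarith), zero_mul]
  · have : 1 < t := by
      by_contra h'; exact ht ⟨not_lt.1 h, not_lt.1 h'⟩
    rw [cut, Real.smoothTransition.zero_of_nonpos (x := n * (1 - t)) (by nlinarith), mul_zero]

/-- the test function -/
def tf (n : ℝ) (x : EuclideanSpace ℝ (Fin 2)) : ℝ := cut n (x 0) * cut n (x 1)

lemma tf_smooth (n : ℝ) : ContDiff ℝ (⊤ : ℕ∞) (tf n) := by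
  unfold tf cut
  have h : ContDiff ℝ (⊤ : ℕ∞) Real.smoothTransition := Real.smoothTransition.contDiff
  fun_prop

lemma tf_zero {n : ℝ} (hn : 0 < n) {x : EuclideanSpace ℝ (Fin 2)} (hx : x ∉ unitSquare) : tf n x = 0 := by
  have : ∃ i : Fin 2, x i ∉ Set.Icc (0:ℝ) 1 := by
    by_contra! h; exact hx h
  obtain ⟨i, hi⟩ := this
  have := cut_eq_zero hn hi
  fin_cases i <;> simp at this <;> simp [tf, this]

lemma isBounded_unitSquare : Bornology.IsBounded unitSquare := by
  refine (Metric.isBounded_closedBall (x := (0:EuclideanSpace ℝ (Fin 2))) (r := 2)).subset ?_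
  intro x hx
  rw [mem_closedBall_zero_iff, EuclideanSpace.norm_eq, Fin.sum_univ_two]
  rw [Real.sqrt_le_left (by norm_num)]
  have h0 := hx 0
  have h1 := hx 1
  simp only [Real.norm_eq_abs, sq_abs]
  nlinarith [h0.1, h0.2, h1.1, h1.2]

lemma tf_compact {n : ℝ} (hn : 0 < n) : HasCompactSupport (tf n) :=
  HasCompactSupport.intro (Metric.isCompact_of_isClosed_isBounded isClosed_unitSquare isBounded_unitSquare)
    fun _ hx => tf_zero hn hx

lemma tf_one {n : ℝ} (hn : 0 < n) {x : EuclideanSpace ℝ (Fin 2)} (hx : ∀ i, x i ∈ Set.Icc (1/n) (1 - 1/n)) : tf n x = 1 := by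
  simp [tf, cut_eq_one hn (hx 0), cut_eq_one hn (hx 1)]

lemma norm_grad (f : EuclideanSpace ℝ (Fin 2) → ℝ) (x : EuclideanSpace ℝ (Fin 2)) : ‖gradient f x‖ = ‖fderiv ℝ f x‖ := by
  simp [gradient]

lemma tf_grad_le {K : ℝ} (hK0 : 0 < K) (hK : ∀ s t : ℝ,
    |Real.smoothTransition s - Real.smoothTransition t| ≤ K * |s - t|) {n : ℝ} (hn : 0 < n) (x : EuclideanSpace ℝ (Fin 2)) :
    ‖gradient (tf n) x‖ ≤ 4 * K * n := by
  rw [norm_grad]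
  have hl : LipschitzWith (Real.toNNReal (4 * K * n)) (tf n) := by
    apply LipschitzWith.of_dist_le_mul
    intro x y
    rw [Real.coe_toNNReal _ (by positivity), Real.dist_eq]
    have h := mul_lip (b := cut n (x 1)) (c := cut n (y 0)) (cut_nonneg n (x 0)) (cut_le_one n (x 0)) (cut_nonneg n (y 1)) (cut_le_one n (y 1))
    have h0 := cut_lip hK hn (x 0) (y 0)
    have h1 := cut_lip hK hn (x 1) (y 1)
    have hc : ∀ i : Fin 2, |x i - y i| ≤ dist x y := by
      intro i
      rw [dist_eq_norm]
      simpa using PiLp.norm_apply_le (x - y) i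
    have h2 := mul_le_mul_of_nonneg_left (hc 0) (show 0 ≤ 2 * K * n by positivity)
    have h3 := mul_le_mul_of_nonneg_left (hc 1) (show 0 ≤ 2 * K * n by positivity)
    unfold tf
    linarith
  have := norm_fderiv_le_of_lipschitz ℝ hl (x₀ := x)
  rwa [Real.coe_toNNReal _ (by positivity)] at this

lemma tf_grad_zero_of {n : ℝ} {x : EuclideanSpace ℝ (Fin 2)} (h : tf n x = 0 ∨ tf n x = 1) : ‖gradient (tf n) x‖ = 0 := by
  rw [norm_grad, norm_eq_zero]
  rcases h with h | h
  · apply IsLocalMin.fderiv_eq_zero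
    refine Filter.Eventually.of_forall fun s => ?_
    rw [h]; exact mul_nonneg (cut_nonneg _ _) (cut_nonneg _ _)
  · apply IsLocalMax.fderiv_eq_zero
    refine Filter.Eventually.of_forall fun s => ?_
    rw [h]; exact mul_le_one₀ (cut_le_one _ _) (cut_nonneg _ _) (cut_le_one _ _)

/-- boundary strips -/
def strips (n : ℝ) : Set (EuclideanSpace ℝ (Fin 2)) :=
  ({x | x 0 ∈ Icc 0 (1/n) ∧ x 1 ∈ Icc (0:ℝ) 1} ∪ {x | x 0 ∈ Icc (1 - 1/n) 1 ∧ x 1 ∈ Icc (0:ℝ) 1}) ∪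
  ({x | x 0 ∈ Icc (0:ℝ) 1 ∧ x 1 ∈ Icc 0 (1/n)} ∪ {x | x 0 ∈ Icc (0:ℝ) 1 ∧ x 1 ∈ Icc (1 - 1/n) 1})

lemma volume_strips {n : ℝ} (hn : 0 < n) : volume (strips n) ≤ ENNReal.ofReal (4 / n) := by
  have e : ENNReal.ofReal (4 / n) = (ENNReal.ofReal (1/n) + ENNReal.ofReal (1/n)) + 
      (ENNReal.ofReal (1/n) + ENNReal.ofReal (1/n)) := by
    rw [← ENNReal.ofReal_add (by positivity) (by positivity), ← ENNReal.ofReal_add (by positivity) (by positivity)]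
    congr 1; ring
  rw [e]
  refine (measure_union_le _ _).trans (add_le_add ((measure_union_le _ _).trans (add_le_add ?_ ?_)) 
    ((measure_union_le _ _).trans (add_le_add ?_ ?_)))
  all_goals
    rw [volume_box _ _ measurableSet_Icc measurableSet_Icc]
    simp

lemma mem_strips {n : ℝ} (hn : 0 < n) {x : EuclideanSpace ℝ (Fin 2)} (h : ‖gradient (tf n) x‖ ≠ 0) : 
    x ∈ strips n ∧ infDist x (frontier unitSquare) ≤ 1 / n := by
  have h0 : tf n x ≠ 0 := fun h' => h (tf_grad_zero_of (Or.inl h'))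
  have h1 : tf n x ≠ 1 := fun h' => h (tf_grad_zero_of (Or.inr h'))
  have hx : x ∈ unitSquare := by
    by_contra h'; exact h0 (tf_zero hn h')
  have : ∃ i : Fin 2, x i ∉ Set.Icc (1/n) (1 - 1/n) := by
    by_contra! h'; exact h1 (tf_one hn h')
  obtain ⟨i, hi⟩ := this
  have hx0 := hx 0
  have hx1 := hx 1
  have hi' : x i ≤ 1/n ∨ 1 - 1/n ≤ x i := by
    by_contra! h'; exact hi ⟨h'.1.le, h'.2.le⟩
  rcases hi' with hi' | hi'
  · refine ⟨?_, (infDist_le_left x hx i).trans hi'⟩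
    fin_cases i
    · exact Or.inl (Or.inl ⟨⟨hx0.1, hi'⟩, hx1⟩)
    · exact Or.inr (Or.inl ⟨hx0, ⟨hx1.1, hi'⟩⟩)
  · refine ⟨?_, (infDist_le_right x hx i).trans (by linarith)⟩
    fin_cases i
    · exact Or.inl (Or.inr ⟨⟨hi', hx0.2⟩, hx1⟩)
    · exact Or.inr (Or.inr ⟨hx0, ⟨hi', hx1.2⟩⟩)

lemma strips_meas (n : ℝ) : MeasurableSet (strips n) := by
  have : ∀ A B : Set ℝ, MeasurableSet A → MeasurableSet B → 
      MeasurableSet {x : EuclideanSpace ℝ (Fin 2) | x 0 ∈ A ∧ x 1 ∈ B} := fun A B hA hB =>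
    mp_pair.measurable (hA.prod hB)
  unfold strips
  refine ((this _ _ ?_ ?_).union (this _ _ ?_ ?_)).union ((this _ _ ?_ ?_).union (this _ _ ?_ ?_)) <;>
    exact measurableSet_Icc

lemma energy_bound {p β : ℝ} (hp : 1 < p) (hβ : 0 < β) : ∃ M : ℝ, 0 < M ∧ ∀ n : ℝ, 0 < n →
    (∫⁻ x, ENNReal.ofReal ‖gradient (tf n) x‖ ^ p *
              ENNReal.ofReal (infDist x (frontier unitSquare)) ^ β ∂volume) ≤ 
      ENNReal.ofReal (M * n ^ (p - 1 - β)) := by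
  obtain ⟨K, hK0, hK⟩ := smoothTransition_lip
  refine ⟨(4 * K) ^ p * 4, by positivity, fun n hn => ?_⟩
  calc _ ≤ ∫⁻ x, (strips n).indicator (fun _ => ENNReal.ofReal (4 * K * n) ^ p * ENNReal.ofReal (1 / n) ^ β) x := by
        apply lintegral_mono
        intro x
        by_cases h : ‖gradient (tf n) x‖ = 0
        · simp only [h, ENNReal.ofReal_zero]
          rw [ENNReal.zero_rpow_of_pos (by linarith), zero_mul]
          exact zero_le
        · obtain ⟨h1, h2⟩ := mem_strips hn h
          rw [indicator_of_mem h1]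
          refine mul_le_mul' ?_ ?_
          · exact ENNReal.rpow_le_rpow (ENNReal.ofReal_le_ofReal (tf_grad_le hK0 hK hn x)) (by linarith)
          · exact ENNReal.rpow_le_rpow (ENNReal.ofReal_le_ofReal h2) hβ.le
    _ = ENNReal.ofReal (4 * K * n) ^ p * ENNReal.ofReal (1 / n) ^ β * volume (strips n) := by
        rw [lintegral_indicator_const (strips_meas n)]
    _ ≤ ENNReal.ofReal (4 * K * n) ^ p * ENNReal.ofReal (1 / n) ^ β * ENNReal.ofReal (4 / n) := by
        gcongr; exact volume_strips hn
    _ = _ := by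
        rw [ENNReal.ofReal_rpow_of_pos (by positivity), ENNReal.ofReal_rpow_of_pos (by positivity),
          ← ENNReal.ofReal_mul (by positivity), ← ENNReal.ofReal_mul (by positivity)]
        congr 1
        rw [Real.mul_rpow (by positivity) hn.le, one_div, Real.inv_rpow hn.le, Real.rpow_sub hn, Real.rpow_sub hn, Real.rpow_one]
        field_simp

lemma first_part (p q : ℝ) (hp : 1 < p) (hpq : p ≤ q) (s β : ℝ) (hβ : p - 1 < β) 
    (C : ℝ) (H : ∀ f : EuclideanSpace ℝ (Fin 2) → ℝ,
        ContDiff ℝ (⊤ : ℕ∞) f → HasCompactSupport f →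
        (∫⁻ x, ENNReal.ofReal |f x| ^ q *
            ENNReal.ofReal (infDist x (frontier unitSquare)) ^ s
              ∂volume) ^ (1 / q) ≤
          ENNReal.ofReal C *
            (∫⁻ x, ENNReal.ofReal ‖gradient f x‖ ^ p *
              ENNReal.ofReal (infDist x (frontier unitSquare)) ^ β ∂volume) ^ (1 / p)) : False := by
  obtain ⟨M, hM, hE⟩ := energy_bound hp (show 0 < β by linarith)
  set B : Set (EuclideanSpace ℝ (Fin 2)) := {x | x 0 ∈ Icc (1/4:ℝ) (3/4) ∧ x 1 ∈ Icc (1/4:ℝ) (3/4)} with hB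
  have hBm : MeasurableSet B := mp_pair.measurable (measurableSet_Icc.prod measurableSet_Icc)
  have hB0 : volume B ≠ 0 := by
    rw [hB, volume_box _ _ measurableSet_Icc measurableSet_Icc]
    simp; norm_num
  set L := ∫⁻ x in B, ENNReal.ofReal (infDist x (frontier unitSquare)) ^ s with hL
  have hL0 : 0 < L := by
    rw [hL, setLIntegral_pos_iff (by fun_prop)]
    have : B ⊆ Function.support (fun x : EuclideanSpace ℝ (Fin 2) => ENNReal.ofReal (infDist x (frontier unitSquare)) ^ s) := by
      intro x hx
      have := infDist_pos_sq x (by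
        refine Fin.forall_fin_two.2 ⟨?_, ?_⟩
        · exact ⟨by linarith [hx.1.1], by linarith [hx.1.2]⟩
        · exact ⟨by linarith [hx.2.1], by linarith [hx.2.2]⟩)
      rw [Function.mem_support, ENNReal.ofReal_rpow_of_pos this]
      have := Real.rpow_pos_of_pos this s
      simpa using this
    rw [inter_eq_right.2 this]
    exact pos_iff_ne_zero.2 hB0
  have hle : ∀ᶠ n : ℝ in Filter.atTop, L ^ (1/q) ≤ ENNReal.ofReal C * (ENNReal.ofReal (M * n ^ (p - 1 - β))) ^ (1/p) := by
    filter_upwards [Filter.eventually_ge_atTop 4] with n hn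
    have hn0 : 0 < n := by linarith
    have hn4 : 1 / n ≤ 1/4 := one_div_le_one_div_of_le (by norm_num) hn
    refine le_trans ?_ ((H (tf n) (tf_smooth n) (tf_compact hn0)).trans ?_)
    · refine ENNReal.rpow_le_rpow ?_ (by have : 0 < q := by linarith
                                         positivity)
      rw [hL, ← lintegral_indicator hBm]
      apply lintegral_mono
      intro x
      by_cases hx : x ∈ B
      · rw [indicator_of_mem hx]
        simp only
        rw [tf_one hn0 (by
          refine Fin.forall_fin_two.2 ⟨?_, ?_⟩
          · exact ⟨by linarith [hx.1.1], by linarith [hx.1.2]⟩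
          · exact ⟨by linarith [hx.2.1], by linarith [hx.2.2]⟩)]
        simp
      · rw [indicator_of_notMem hx]; exact zero_le
    · gcongr
      exact hE n hn0
  have ht : Filter.Tendsto (fun n : ℝ => ENNReal.ofReal C * (ENNReal.ofReal (M * n ^ (p - 1 - β))) ^ (1/p)) 
      Filter.atTop (nhds 0) := by
    have h1 : Filter.Tendsto (fun n : ℝ => M * n ^ (p - 1 - β)) Filter.atTop (nhds (M * 0)) := by
      apply Filter.Tendsto.const_mul
      have := tendsto_rpow_neg_atTop (show 0 < β - (p - 1) by linarith)
      simpa using this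
    have h2 := ((ENNReal.continuous_rpow_const (y := 1/p)).tendsto _).comp (ENNReal.tendsto_ofReal h1)
    have h3 := ENNReal.Tendsto.const_mul (a := ENNReal.ofReal C) h2 (Or.inr ENNReal.ofReal_ne_top)
    have hp0 : 0 < 1 / p := by positivity
    simpa [ENNReal.zero_rpow_of_pos (show 0 < p⁻¹ by positivity)] using h3
  have h0 := ge_of_tendsto ht hle
  have h1 : 0 < L ^ (1/q) := by
    rw [pos_iff_ne_zero, Ne, ENNReal.rpow_eq_zero_iff_of_pos (by have : 0 < q := by linarith
                                                                 positivity)]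
    exact hL0.ne'
  exact absurd h0 (not_le.2 h1)

lemma lower_log {n : ℝ} (hn : 4 ≤ n) {p : ℝ}: 
    ENNReal.ofReal (Real.log (n / 4) / 2) ≤ 
    ∫⁻ x, ENNReal.ofReal |tf n x| ^ p * ENNReal.ofReal (infDist x (frontier unitSquare)) ^ (-1 : ℝ) := by
  have hn0 : 0 < n := by linarith
  have hn4 : 1 / n ≤ 1/4 := one_div_le_one_div_of_le (by norm_num) hn
  have hn1 : 0 < 1 / n := by positivity
  set A : Set ℝ := Ioc (1/n) (1/4) with hA
  set B : Set ℝ := Icc (1/4) (3/4) with hB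
  calc _ = (∫⁻ t, A.indicator (fun t => ENNReal.ofReal t⁻¹) t) * ∫⁻ t, B.indicator (fun _ => (1:ℝ≥0∞)) t := by
        rw [lintegral_indicator measurableSet_Ioc, lintegral_indicator_const measurableSet_Icc,
          ← ofReal_integral_eq_lintegral_ofReal, ← intervalIntegral.integral_of_le hn4, integral_inv_of_pos hn1 (by norm_num)]
        · rw [one_mul, Real.volume_Icc, ← ENNReal.ofReal_mul]
          · congr 1
            rw [show (1/4 / (1/n) : ℝ) = n / 4 by field_simp]; ring
          · apply Real.log_nonneg
            rw [le_div_iff₀ hn1]; linarith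
        · rw [← IntegrableOn, ← intervalIntegrable_iff_integrableOn_Ioc_of_le hn4]
          apply intervalIntegral.intervalIntegrable_inv
          · intro x hx
            rw [uIcc_of_le hn4] at hx
            linarith [hx.1]
          · fun_prop
        · filter_upwards [ae_restrict_mem measurableSet_Ioc] with t ht
          have : 0 < t := hn1.trans ht.1
          positivity
    _ = ∫⁻ z : ℝ × ℝ, A.indicator (fun t => ENNReal.ofReal t⁻¹) z.1 * B.indicator (fun _ => (1:ℝ≥0∞)) z.2 := by
        rw [Measure.volume_eq_prod, lintegral_prod_mul]
        · exact ((by fun_prop : Measurable fun t : ℝ => ENNReal.ofReal t⁻¹).indicator measurableSet_Ioc).aemeasurable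
        · exact (measurable_const.indicator measurableSet_Icc).aemeasurable
    _ = ∫⁻ x : EuclideanSpace ℝ (Fin 2), A.indicator (fun t => ENNReal.ofReal t⁻¹) (x 0) * B.indicator (fun _ => (1:ℝ≥0∞)) (x 1) := by
        rw [← mp_pair.lintegral_comp]
        exact (((by fun_prop : Measurable fun t : ℝ => ENNReal.ofReal t⁻¹).indicator measurableSet_Ioc).comp measurable_fst).mul
          ((measurable_const.indicator measurableSet_Icc).comp measurable_snd)
    _ ≤ _ := by
        apply lintegral_mono
        intro x
        by_cases h0 : x 0 ∈ A
        swap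
        · simp [indicator_of_notMem h0]
        by_cases h1 : x 1 ∈ B
        swap
        · simp [indicator_of_notMem h1]
        have hx : ∀ i, x i ∈ Set.Icc (1/n) (1 - 1/n) := by
          refine Fin.forall_fin_two.2 ⟨?_, ?_⟩
          · exact ⟨by linarith [h0.1], by linarith [h0.2]⟩
          · exact ⟨by linarith [h1.1], by linarith [h1.2]⟩
        simp only [indicator_of_mem h0, indicator_of_mem h1, tf_one hn0 hx]
        rw [mul_one, abs_one, ENNReal.ofReal_one, ENNReal.one_rpow, one_mul, ENNReal.rpow_neg_one,
          ENNReal.ofReal_inv_of_pos (hn1.trans h0.1)]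
        rw [ENNReal.inv_le_inv]
        apply ENNReal.ofReal_le_ofReal
        apply infDist_le_left
        intro i
        exact ⟨by linarith [(hx i).1], by linarith [(hx i).2]⟩

lemma second_part (p : ℝ) (hp : 1 < p)  
    (C : ℝ) (H : ∀ f : EuclideanSpace ℝ (Fin 2) → ℝ,
        ContDiff ℝ (⊤ : ℕ∞) f → HasCompactSupport f →
        (∫⁻ x, ENNReal.ofReal |f x| ^ p *
            ENNReal.ofReal (infDist x (frontier unitSquare)) ^ (-1 : ℝ)
              ∂volume) ^ (1 / p) ≤
          ENNReal.ofReal C *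
            (∫⁻ x, ENNReal.ofReal ‖gradient f x‖ ^ p *
              ENNReal.ofReal (infDist x (frontier unitSquare)) ^ (p - 1) ∂volume) ^ (1 / p)) : False := by
  obtain ⟨M, hM, hE⟩ := energy_bound hp (show 0 < p - 1 by linarith)
  have hp0 : 0 < 1 / p := by positivity
  set D : ℝ≥0∞ := ENNReal.ofReal C * (ENNReal.ofReal M) ^ (1/p) with hD
  have hDt : D ≠ ∞ := ENNReal.mul_ne_top ENNReal.ofReal_ne_top 
    (ENNReal.rpow_ne_top_of_nonneg hp0.le ENNReal.ofReal_ne_top)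
  have hle : ∀ᶠ n : ℝ in Filter.atTop, (ENNReal.ofReal (Real.log (n / 4) / 2)) ^ (1/p) ≤ D := by
    filter_upwards [Filter.eventually_ge_atTop 4] with n hn
    have hn0 : 0 < n := by linarith
    refine le_trans ?_ ((H (tf n) (tf_smooth n) (tf_compact hn0)).trans ?_)
    · exact ENNReal.rpow_le_rpow (lower_log hn) hp0.le
    · rw [hD]
      gcongr
      simpa using hE n hn0
  have ht : Filter.Tendsto (fun n : ℝ => (ENNReal.ofReal (Real.log (n / 4) / 2)) ^ (1/p)) 
      Filter.atTop (nhds ⊤) := by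
    have h1 : Filter.Tendsto (fun n : ℝ => Real.log (n / 4) / 2) Filter.atTop Filter.atTop := 
      (Real.tendsto_log_atTop.comp (Filter.tendsto_id.atTop_div_const (by norm_num))).atTop_div_const (by norm_num)
    have h2 := ((ENNReal.continuous_rpow_const (y := 1/p)).tendsto _).comp (ENNReal.tendsto_ofReal_nhds_top.2 h1)
    rw [ENNReal.top_rpow_of_pos hp0] at h2
    exact h2
  exact hDt (top_le_iff.1 (le_of_tendsto ht hle))

theorem hardy_sobolev_fails_boundary_square
    (p q : ℝ) (hp : 1 < p) (hpq : p ≤ q) (hp2 : p < 2) (hq : q ≤ 2 * p / (2 - p)) :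
    (∀ β : ℝ, p - 1 < β →
      ¬ ∃ C : ℝ, 0 < C ∧ ∀ f : EuclideanSpace ℝ (Fin 2) → ℝ,
        ContDiff ℝ (⊤ : ℕ∞) f → HasCompactSupport f →
        (∫⁻ x, ENNReal.ofReal |f x| ^ q *
            ENNReal.ofReal (infDist x (frontier unitSquare)) ^ (q / p * (2 - p + β) - 2)
              ∂volume) ^ (1 / q) ≤
          ENNReal.ofReal C *
            (∫⁻ x, ENNReal.ofReal ‖gradient f x‖ ^ p *
              ENNReal.ofReal (infDist x (frontier unitSquare)) ^ β ∂volume) ^ (1 / p)) ∧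
    (q = p →
      ¬ ∃ C : ℝ, 0 < C ∧ ∀ f : EuclideanSpace ℝ (Fin 2) → ℝ,
        ContDiff ℝ (⊤ : ℕ∞) f → HasCompactSupport f →
        (∫⁻ x, ENNReal.ofReal |f x| ^ q *
            ENNReal.ofReal (infDist x (frontier unitSquare)) ^ (q / p * (2 - p + (p - 1)) - 2)
              ∂volume) ^ (1 / q) ≤
          ENNReal.ofReal C *
            (∫⁻ x, ENNReal.ofReal ‖gradient f x‖ ^ p *
              ENNReal.ofReal (infDist x (frontier unitSquare)) ^ (p - 1) ∂volume) ^ (1 / p)) := by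
  refine ⟨fun β hβ => ?_, fun hqp => ?_⟩
  · rintro ⟨C, _, H⟩
    exact first_part p q hp hpq _ β hβ C H
  · rintro ⟨C, _, H⟩
    subst hqp
    have e : q / q * (2 - q + (q - 1)) - 2 = -1 := by
      rw [div_self (by linarith)]; ring
    rw [e] at H
    exact second_part q hp C H

end
end ApDistance
end
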